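/- arXiv:1904.09536 — 3 statements merged into one kernel-verified Lean document; each statement's English description precedes it below -/
import Mathlib

section
/- Let 0 < q < 1, let α, β, γ, δ > 0 and let N ∈ ℕ satisfy α·β = q^N·γ·δ. Then there exist ℝ-linear functionals φ₀ : ℳ → ℝ and φ₁ : ℳ → ℝ such that: (i) for every integer L with 1 ≤ L ≤ N one has φ₀((𝐃+𝐄)^L) ≠ 0, and the function P : {0,1}^L → ℝ defined by P(τ₁,…,τ_L) = φ₀(∏_{j=1}^{L}(τ_j·𝐃 + (1−τ_j)·𝐄)) / φ₀((𝐃+𝐄)^L) is nonnegative, sums to 1 over {0,1}^L, and satisfies the ASEP stationarity equations with parameters (α,β,γ,δ,q); (ii) for every integer L ≥ N+1 one has φ₁((𝐃+𝐄)^L) ≠ 0, and the function P defined by the same formula with φ₁ in place of φ₀ is nonnegative, sums to 1, and satisfies the ASEP stationarity equations; (iii) for L = N+1 this function is the Bernoulli product measure: P(τ₁,…,τ_{N+1}) = ∏_{j=1}^{N+1} p_j^{τ_j}·(1−p_j)^{1−τ_j}, where p_j = α/(α + γ·q^{j−1}). -/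
noncomputable section

open scoped BigOperators

/-- numeric indicator of a Boolean site value: `1` if occupied, `0` if empty. -/
def indic (b : Bool) : ℝ := if b then 1 else 0

/-- `P : {0,1}^L → ℝ` satisfies the ASEP stationarity equations with
parameters `(α,β,γ,δ,q)`. -/
def ASEPStationary (q α β γ δ : ℝ) (L : ℕ) (hL : 0 < L) (P : (Fin L → Bool) → ℝ) : Prop :=
  ∀ τ : Fin L → Bool,
    (indic (τ ⟨0, hL⟩) - indic (!τ ⟨0, hL⟩)) *
        (α * P (Function.update τ ⟨0, hL⟩ false) - γ * P (Function.update τ ⟨0, hL⟩ true))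
      + (∑ k : Fin (L - 1),
          (indic (τ ⟨(k : ℕ) + 1, Nat.add_lt_of_lt_sub k.isLt⟩)
              - indic (τ ⟨(k : ℕ), Nat.lt_of_succ_lt (Nat.add_lt_of_lt_sub k.isLt)⟩)) *
            (P (Function.update (Function.update τ
                  ⟨(k : ℕ), Nat.lt_of_succ_lt (Nat.add_lt_of_lt_sub k.isLt)⟩ true)
                  ⟨(k : ℕ) + 1, Nat.add_lt_of_lt_sub k.isLt⟩ false)
              - q * P (Function.update (Function.update τ
                  ⟨(k : ℕ), Nat.lt_of_succ_lt (Nat.add_lt_of_lt_sub k.isLt)⟩ false)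
                  ⟨(k : ℕ) + 1, Nat.add_lt_of_lt_sub k.isLt⟩ true)))
      + (indic (!τ ⟨L - 1, Nat.sub_lt hL Nat.one_pos⟩)
            - indic (τ ⟨L - 1, Nat.sub_lt hL Nat.one_pos⟩)) *
          (β * P (Function.update τ ⟨L - 1, Nat.sub_lt hL Nat.one_pos⟩ true)
            - δ * P (Function.update τ ⟨L - 1, Nat.sub_lt hL Nat.one_pos⟩ false)) = 0

/-- The defining relation `𝐃𝐄 - q·𝐄𝐃 = 𝐃 + 𝐄` of the algebra `ℳ`
(generator `0` is `𝐃`, generator `1` is `𝐄`). -/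
inductive ASEPrel (q : ℝ) : FreeAlgebra ℝ (Fin 2) → FreeAlgebra ℝ (Fin 2) → Prop
  | rel : ASEPrel q
      (FreeAlgebra.ι ℝ (0 : Fin 2) * FreeAlgebra.ι ℝ (1 : Fin 2)
        - q • (FreeAlgebra.ι ℝ (1 : Fin 2) * FreeAlgebra.ι ℝ (0 : Fin 2)))
      (FreeAlgebra.ι ℝ (0 : Fin 2) + FreeAlgebra.ι ℝ (1 : Fin 2))

/-- The algebra `ℳ`: the free `ℝ`-algebra on generators `𝐃, 𝐄` modulo the
two-sided ideal generated by `𝐃𝐄 - q·𝐄𝐃 - (𝐃 + 𝐄)`. -/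
abbrev Malg (q : ℝ) : Type := RingQuot (ASEPrel q)

/-- The generator `𝐃` of `ℳ`. -/
def Dgen (q : ℝ) : Malg q := RingQuot.mkAlgHom ℝ (ASEPrel q) (FreeAlgebra.ι ℝ (0 : Fin 2))

/-- The generator `𝐄` of `ℳ`. -/
def Egen (q : ℝ) : Malg q := RingQuot.mkAlgHom ℝ (ASEPrel q) (FreeAlgebra.ι ℝ (1 : Fin 2))

/-- The candidate stationary probabilities produced by a linear functional `φ` on `ℳ`. -/
def Pfun (q : ℝ) (φ : Malg q →ₗ[ℝ] ℝ) (L : ℕ) (τ : Fin L → Bool) : ℝ :=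
  φ (List.ofFn fun j : Fin L => if τ j then Dgen q else Egen q).prod
    / φ ((Dgen q + Egen q) ^ L)

/-! ### Finite Markov chains driven by involutions -/

section Chain

variable {Ω ι : Type*} [Fintype ι]

/-- A nonnegative solution of the balance equations that vanishes somewhere vanishes
everywhere. -/
lemma balance_eq_zero_of_nonneg (m : ι → Ω → Ω) (r : ι → Ω → ℝ) (hr : ∀ i τ, 0 < r i τ)
    (hconn : ∀ S : Set Ω, S.Nonempty → (∀ i, ∀ τ ∈ S, m i τ ∈ S) → S = Set.univ)
    (P : Ω → ℝ) (hP : ∀ τ, 0 ≤ P τ)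
    (hbal : ∀ τ, ∑ i, r i (m i τ) * P (m i τ) = ∑ i, r i τ * P τ)
    (τ₀ : Ω) (h₀ : P τ₀ = 0) (τ : Ω) : P τ = 0 := by
  have key : {τ | P τ = 0} = Set.univ := by
    refine hconn _ ⟨τ₀, h₀⟩ fun i τ hτ => ?_
    have hτ' : P τ = 0 := hτ
    have h := hbal τ
    simp only [hτ', mul_zero, Finset.sum_const_zero] at h
    rw [Finset.sum_eq_zero_iff_of_nonneg
      (fun i _ => mul_nonneg (hr i _).le (hP _))] at h
    exact (mul_eq_zero.mp (h i (Finset.mem_univ i))).resolve_left (hr i _).ne'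
  exact (Set.ext_iff.mp key τ).mpr trivial

/-- Every solution of the balance equations of an irreducible chain has constant sign. -/
lemma balance_nonpos_or_pos [Fintype Ω] (m : ι → Ω → Ω) (hm : ∀ i, Function.Involutive (m i))
    (r : ι → Ω → ℝ) (hr : ∀ i τ, 0 < r i τ)
    (hconn : ∀ S : Set Ω, S.Nonempty → (∀ i, ∀ τ ∈ S, m i τ ∈ S) → S = Set.univ)
    (P : Ω → ℝ) (hbal : ∀ τ, ∑ i, r i (m i τ) * P (m i τ) = ∑ i, r i τ * P τ) :
    (∀ τ, P τ ≤ 0) ∨ (∀ τ, 0 < P τ) := by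
  have hle : ∀ τ, ∑ i, r i τ * |P τ| ≤ ∑ i, r i (m i τ) * |P (m i τ)| := fun τ => by
    have h1 : ∑ i, r i τ * |P τ| = |∑ i, r i τ * P τ| := by
      rw [← Finset.sum_mul, ← Finset.sum_mul, abs_mul,
        abs_of_nonneg (Finset.sum_nonneg fun i _ => (hr i τ).le)]
    rw [h1, ← hbal τ]
    refine (Finset.abs_sum_le_sum_abs _ _).trans (Finset.sum_le_sum fun i _ => ?_)
    rw [abs_mul, abs_of_pos (hr _ _)]
  have hsum : ∑ τ, ∑ i, r i τ * |P τ| = ∑ τ, ∑ i, r i (m i τ) * |P (m i τ)| := by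
    rw [Finset.sum_comm, Finset.sum_comm (f := fun τ i => r i (m i τ) * |P (m i τ)|)]
    exact Finset.sum_congr rfl fun i _ =>
      ((hm i).bijective.sum_comp fun τ => r i τ * |P τ|).symm
  have habs : ∀ τ, ∑ i, r i τ * |P τ| = ∑ i, r i (m i τ) * |P (m i τ)| := fun τ =>
    (Finset.sum_eq_sum_iff_of_le fun τ _ => hle τ).mp hsum τ (Finset.mem_univ τ)
  by_cases h : ∃ τ₀, P τ₀ ≤ 0
  · obtain ⟨τ₀, h₀⟩ := h
    refine Or.inl fun τ => ?_
    have h : |P τ| + P τ = 0 := balance_eq_zero_of_nonneg m r hr hconn (fun τ => |P τ| + P τ)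
      (fun τ => by linarith [neg_abs_le (P τ)])
      (fun τ => by simp only [mul_add, Finset.sum_add_distrib, habs τ, hbal τ])
      τ₀ (by simp [abs_of_nonpos h₀]) τ
    linarith [abs_nonneg (P τ)]
  · push Not at h
    exact Or.inr h

end Chain

/-! ### Moves on configurations -/

/-- Flip the occupation of one site. -/
def flipSite {L : ℕ} (k : Fin L) (τ : Fin L → Bool) : Fin L → Bool :=
  Function.update τ k (!τ k)

/-- Exchange the occupations of two sites. -/
def swapSites {L : ℕ} (j k : Fin L) (τ : Fin L → Bool) : Fin L → Bool :=
  τ ∘ Equiv.swap j k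

lemma flipSite_involutive {L : ℕ} (k : Fin L) : Function.Involutive (flipSite k) := fun τ => by
  simp [flipSite]

lemma swapSites_involutive {L : ℕ} (j k : Fin L) :
    Function.Involutive (swapSites (L := L) j k) := fun τ => by
  ext i; simp [swapSites]

lemma swapSites_of_eq {L : ℕ} {j k : Fin L} {τ : Fin L → Bool} (h : τ j = τ k) :
    swapSites j k τ = τ := by
  ext i
  simp only [swapSites, Function.comp, Equiv.swap_apply_def]
  split_ifs <;> simp_all

lemma swapSites_eq_update {L : ℕ} (j k : Fin L) (τ : Fin L → Bool) :
    swapSites j k τ = Function.update (Function.update τ j (τ k)) k (τ j) := by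
  ext i
  simp only [swapSites, Function.comp, Equiv.swap_apply_def, Function.update_apply]
  split_ifs <;> simp_all

lemma flipSite_eq_conj {L : ℕ} {j k : Fin L} (τ : Fin L → Bool) :
    flipSite k τ = swapSites j k (flipSite j (swapSites j k τ)) := by
  ext i
  simp only [swapSites, flipSite, Function.comp, Equiv.swap_apply_def, Function.update_apply]
  split_ifs <;> simp_all

/-- A set of configurations that is invariant under flips of the first site and exchanges of
neighbours is everything. -/
lemma eq_univ_of_moves {L : ℕ} (hL : 0 < L) (S : Set (Fin L → Bool)) (hS : S.Nonempty)
    (hflip : ∀ τ ∈ S, flipSite ⟨0, hL⟩ τ ∈ S)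
    (hswap : ∀ (k : ℕ) (hk : k + 1 < L), ∀ τ ∈ S,
      swapSites ⟨k, Nat.lt_of_succ_lt hk⟩ ⟨k + 1, hk⟩ τ ∈ S) : S = Set.univ := by
  have hall : ∀ (k : ℕ) (hk : k < L), ∀ τ ∈ S, flipSite ⟨k, hk⟩ τ ∈ S := by
    intro k
    induction k with
    | zero => exact fun _ => hflip
    | succ k ih =>
      intro hk τ hτ
      rw [flipSite_eq_conj (j := ⟨k, Nat.lt_of_succ_lt hk⟩)]
      exact hswap k hk _ (ih _ _ (hswap k hk _ hτ))
  obtain ⟨τ, hτ⟩ := hS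
  refine Set.eq_univ_of_forall fun σ => ?_
  have hpart : ∀ s : Finset (Fin L), (fun i => if i ∈ s then σ i else τ i) ∈ S := by
    intro s
    induction s using Finset.induction_on with
    | empty => simpa using hτ
    | insert a s ha ih =>
      by_cases h : σ a = τ a
      · convert ih using 2 with i
        by_cases hi : i = a <;> simp_all
      · convert hall a a.isLt _ ih using 1
        ext i
        by_cases hi : i = a
        · subst hi
          simp only [flipSite, Finset.mem_insert, true_or, if_true, Function.update_self, ha,
            if_false]
          rw [Bool.not_eq.mpr (Ne.symm h)]
        · simp [flipSite, hi]
  simpa using hpart Finset.univ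

/-! ### A polynomial representation of the algebra -/

section Representation

open Polynomial

/-- The image of `X ^ k` under the operator representing `𝐃`. -/
def dImage (q β δ : ℝ) : ℕ → ℝ[X]
  | 0 => C β⁻¹ + C (δ / β) * X
  | k + 1 => (C q * X + 1) * dImage q β δ k + X ^ (k + 1)

/-- The operator on polynomials representing `𝐃`. -/
def dOp (q β δ : ℝ) : Module.End ℝ ℝ[X] :=
  (Polynomial.basisMonomials ℝ).constr ℝ (dImage q β δ)

/-- The operator on polynomials representing `𝐄`. -/
def eOp : Module.End ℝ ℝ[X] := LinearMap.mulLeft ℝ X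

lemma dOp_X_pow (q β δ : ℝ) (k : ℕ) : dOp q β δ (X ^ k) = dImage q β δ k := by
  simpa [dOp, X_pow_eq_monomial] using
    (Polynomial.basisMonomials ℝ).constr_basis ℝ (dImage q β δ) k

lemma eOp_apply (p : ℝ[X]) : eOp p = X * p := rfl

lemma linearMap_ext_X_pow {V : Type*} [AddCommMonoid V] [Module ℝ V] {f g : ℝ[X] →ₗ[ℝ] V}
    (h : ∀ k, f (X ^ k) = g (X ^ k)) : f = g := by
  refine (Polynomial.basisMonomials ℝ).ext fun k => ?_
  simpa [X_pow_eq_monomial] using h k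

lemma dOp_mul_eOp (q β δ : ℝ) :
    dOp q β δ * eOp - q • (eOp * dOp q β δ) = dOp q β δ + eOp := by
  refine linearMap_ext_X_pow fun k => ?_
  simp only [LinearMap.sub_apply, LinearMap.smul_apply, LinearMap.add_apply, Module.End.mul_apply,
    eOp_apply, ← pow_succ', dOp_X_pow, dImage, smul_eq_C_mul]
  ring

/-- The representation of the algebra on polynomials in which `1` is a vacuum vector for
`β 𝐃 - δ 𝐄 - 1`. -/
def polyRep (q β δ : ℝ) : Malg q →ₐ[ℝ] Module.End ℝ ℝ[X] :=
  RingQuot.liftAlgHom ℝ ⟨FreeAlgebra.lift ℝ ![dOp q β δ, eOp], by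
    rintro _ _ ⟨⟩
    simpa using dOp_mul_eOp q β δ⟩

lemma polyRep_Dgen (q β δ : ℝ) : polyRep q β δ (Dgen q) = dOp q β δ := by
  simp [polyRep, Dgen]

lemma polyRep_Egen (q β δ : ℝ) : polyRep q β δ (Egen q) = eOp := by
  simp [polyRep, Egen]

lemma Dgen_mul_Egen (q : ℝ) :
    Dgen q * Egen q - q • (Egen q * Dgen q) = Dgen q + Egen q := by
  simpa [Dgen, Egen] using RingQuot.mkAlgHom_rel ℝ (ASEPrel.rel (q := q))

lemma dImage_sub_mem (q β δ : ℝ) (k : ℕ) :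
    dImage q β δ k - C (q ^ k * δ / β) * X ^ (k + 1) ∈ degreeLT ℝ (k + 1) := by
  induction k with
  | zero =>
    rw [mem_degreeLT]
    have : dImage q β δ 0 - C (q ^ 0 * δ / β) * X ^ (0 + 1) = C β⁻¹ := by
      simp [dImage]
    rw [this]
    exact degree_C_le.trans_lt (by norm_num)
  | succ k ih =>
    rw [mem_degreeLT] at ih ⊢
    set r := dImage q β δ k - C (q ^ k * δ / β) * X ^ (k + 1) with hr
    have : dImage q β δ (k + 1) - C (q ^ (k + 1) * δ / β) * X ^ (k + 1 + 1)
        = (C q * X + 1) * r + C (q ^ k * δ / β + 1) * X ^ (k + 1) := by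
      have hc : q ^ (k + 1) * δ / β = q * (q ^ k * δ / β) := by ring
      rw [hr, dImage, hc, C_mul, C_add, C_1]
      ring
    rw [this, degree_lt_iff_coeff_zero]
    rw [degree_lt_iff_coeff_zero] at ih
    intro j hj
    obtain ⟨j, rfl⟩ : ∃ i, j = i + 1 := ⟨j - 1, by omega⟩
    simp only [add_mul, mul_assoc, coeff_add, coeff_C_mul, coeff_X_mul, one_mul, coeff_X_pow]
    rw [ih j (by omega), ih (j + 1) (by omega), if_neg (by omega)]
    simp

/-- The operator `α 𝐄 - γ 𝐃 - 1` on polynomials. -/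
def leftDefect (q α β γ δ : ℝ) : Module.End ℝ ℝ[X] := α • eOp - γ • dOp q β δ - 1

lemma leftDefect_sub_mem (q α β γ δ : ℝ) (k : ℕ) :
    leftDefect q α β γ δ (X ^ k) - C (α - γ * (q ^ k * δ / β)) * X ^ (k + 1)
      ∈ degreeLT ℝ (k + 1) := by
  have h1 := (degreeLT ℝ (k + 1)).smul_mem (-γ) (dImage_sub_mem q β δ k)
  have h2 : (X ^ k : ℝ[X]) ∈ degreeLT ℝ (k + 1) := by
    rw [mem_degreeLT, degree_X_pow]; exact_mod_cast k.lt_succ_self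
  convert Submodule.sub_mem _ h1 h2 using 1
  simp only [leftDefect, LinearMap.sub_apply, LinearMap.smul_apply, Module.End.one_apply,
    eOp_apply, dOp_X_pow, smul_eq_C_mul, C_sub, C_mul, C_neg]
  ring

lemma map_eq_zero_of_mem_degreeLT {V : Type*} [AddCommMonoid V] [Module ℝ V] {n : ℕ}
    {f : ℝ[X] →ₗ[ℝ] V} (h : ∀ k < n, f (X ^ k) = 0) {p : ℝ[X]} (hp : p ∈ degreeLT ℝ n) :
    f p = 0 := by
  classical
  rw [degreeLT_eq_span_X_pow] at hp
  refine (Submodule.span_le (p := LinearMap.ker f)).mpr ?_ hp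
  intro x hx
  simp only [Finset.coe_image, Set.mem_image, Finset.coe_range, Set.mem_Iio] at hx
  obtain ⟨k, hk, rfl⟩ := hx
  exact h k hk

lemma dOp_mem_degreeLT (q β δ : ℝ) {n : ℕ} {p : ℝ[X]} (hp : p ∈ degreeLT ℝ n) :
    dOp q β δ p ∈ degreeLT ℝ (n + 1) := by
  have := map_eq_zero_of_mem_degreeLT (n := n)
    (f := (degreeLT ℝ (n + 1)).mkQ ∘ₗ dOp q β δ) (fun k hk => ?_) hp
  · simpa using this
  · rw [LinearMap.comp_apply, Submodule.mkQ_apply, Submodule.Quotient.mk_eq_zero, dOp_X_pow]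
    have h1 := degreeLT_mono (R := ℝ) (show k + 1 ≤ n + 1 by omega) (dImage_sub_mem q β δ k)
    have h2 : C (q ^ k * δ / β) * X ^ (k + 1) ∈ degreeLT ℝ (n + 1) := by
      rw [mem_degreeLT]
      exact (degree_C_mul_X_pow_le _ _).trans_lt (by exact_mod_cast Nat.succ_lt_succ hk)
    simpa using Submodule.add_mem _ h1 h2

lemma eOp_mem_degreeLT {n : ℕ} {p : ℝ[X]} (hp : p ∈ degreeLT ℝ n) :
    eOp p ∈ degreeLT ℝ (n + 1) := by
  rw [mem_degreeLT, degree_lt_iff_coeff_zero] at hp ⊢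
  intro j hj
  obtain ⟨j, rfl⟩ : ∃ i, j = i + 1 := ⟨j - 1, by omega⟩
  rw [eOp_apply, coeff_X_mul]
  exact hp j (by omega)

/-- Linear functionals vanishing below degree `m`, normalized in degree `m`, and invariant under
`α 𝐄 - γ 𝐃` from degree `m` on, except at singular degrees. -/
lemma exists_linear_functional (q α β γ δ : ℝ) (hβ : β ≠ 0) (m : ℕ) :
    ∃ ℓ : ℝ[X] →ₗ[ℝ] ℝ, (∀ k < m, ℓ (X ^ k) = 0) ∧ ℓ (X ^ m) = 1 ∧
      ∀ k, m ≤ k → α * β ≠ q ^ k * γ * δ → ℓ (leftDefect q α β γ δ (X ^ k)) = 0 := by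
  classical
  let s : ℕ → ℝ[X] := fun i => if m < i ∧ α * β ≠ q ^ (i - 1) * γ * δ then
    leftDefect q α β γ δ (X ^ (i - 1)) else X ^ i
  have hs : ∀ i, (s i).degree = i := by
    intro i
    by_cases h : m < i ∧ α * β ≠ q ^ (i - 1) * γ * δ
    · obtain ⟨k, rfl⟩ : ∃ k, i = k + 1 := ⟨i - 1, by omega⟩
      simp only [s, if_pos h, Nat.add_sub_cancel]
      rw [Nat.add_sub_cancel] at h
      have hc : α - γ * (q ^ k * δ / β) ≠ 0 := fun h0 => h.2 (by
        field_simp at h0; linarith)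
      have hd : (C (α - γ * (q ^ k * δ / β)) * X ^ (k + 1)).degree = ((k + 1 : ℕ) : WithBot ℕ) :=
        degree_C_mul_X_pow _ hc
      have := mem_degreeLT.mp (leftDefect_sub_mem q α β γ δ k)
      rw [← hd] at this
      rw [← hd]
      rw [← degree_add_eq_right_of_degree_lt this, sub_add_cancel]
    · simp only [s, if_neg h, degree_X_pow]
  let S : Polynomial.Sequence ℝ := ⟨s, hs⟩
  have hu : ∀ i, IsUnit (S i).leadingCoeff := fun i =>
    (leadingCoeff_ne_zero.mpr (S.ne_zero i)).isUnit
  let b := S.basis hu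
  let ℓ := b.constr ℝ (fun i => if i = m then (1 : ℝ) else 0)
  have hℓ : ∀ i, ℓ (s i) = if i = m then (1 : ℝ) else 0 := fun i => by
    have := b.constr_basis ℝ (fun i => if i = m then (1 : ℝ) else 0) i
    rwa [Sequence.basis_eq_self] at this
  refine ⟨ℓ, fun k hk => ?_, ?_, fun k hk hne => ?_⟩
  · have := hℓ k
    rwa [if_neg hk.ne, show s k = X ^ k from if_neg (by omega)] at this
  · have := hℓ m
    rwa [if_pos rfl, show s m = X ^ m from if_neg (by omega)] at this
  · have := hℓ (k + 1)
    rwa [if_neg (by omega), show s (k + 1) = leftDefect q α β γ δ (X ^ k) from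
      if_pos ⟨by omega, hne⟩] at this

/-- The word in `𝐃` and `𝐄` attached to a list of occupations. -/
def word (q : ℝ) (l : List Bool) : Malg q :=
  (l.map fun b => if b then Dgen q else Egen q).prod

lemma word_cons (q : ℝ) (b : Bool) (l : List Bool) :
    word q (b :: l) = (if b then Dgen q else Egen q) * word q l := by
  simp [word]

lemma word_append (q : ℝ) (l l' : List Bool) : word q (l ++ l') = word q l * word q l' := by
  simp [word]

lemma word_nil (q : ℝ) : word q [] = 1 := by simp [word]

lemma polyRep_word_mem (q β δ : ℝ) (l : List Bool) :
    polyRep q β δ (word q l) 1 ∈ degreeLT ℝ (l.length + 1) := by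
  induction l with
  | nil =>
    rw [word_nil, map_one (polyRep q β δ), Module.End.one_apply, mem_degreeLT]
    exact degree_one_le.trans_lt (by norm_num)
  | cons b l ih =>
    rw [word_cons, map_mul, Module.End.mul_apply, List.length_cons]
    cases b
    · simpa [polyRep_Egen] using eOp_mem_degreeLT ih
    · simpa [polyRep_Dgen] using dOp_mem_degreeLT q β δ ih

/-- The functional on the algebra obtained from a functional on polynomials by applying to the
vacuum vector. -/
def vacuumFunctional (q β δ : ℝ) (ℓ : ℝ[X] →ₗ[ℝ] ℝ) : Malg q →ₗ[ℝ] ℝ :=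
  ℓ ∘ₗ LinearMap.applyₗ (1 : ℝ[X]) ∘ₗ (polyRep q β δ).toLinearMap

lemma vacuumFunctional_apply (q β δ : ℝ) (ℓ : ℝ[X] →ₗ[ℝ] ℝ) (a : Malg q) :
    vacuumFunctional q β δ ℓ a = ℓ (polyRep q β δ a 1) := rfl

lemma vacuumFunctional_mul_right (q β δ : ℝ) (hβ : β ≠ 0) (ℓ : ℝ[X] →ₗ[ℝ] ℝ) (a : Malg q) :
    β * vacuumFunctional q β δ ℓ (a * Dgen q) - δ * vacuumFunctional q β δ ℓ (a * Egen q)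
      = vacuumFunctional q β δ ℓ a := by
  have h : β • dOp q β δ 1 - δ • eOp 1 = (1 : ℝ[X]) := by
    have h0 := dOp_X_pow q β δ 0
    rw [pow_zero] at h0
    rw [h0, eOp_apply, dImage, smul_eq_C_mul, smul_eq_C_mul, mul_add, ← mul_assoc, ← C_mul,
      ← C_mul, mul_inv_cancel₀ hβ, mul_div_cancel₀ _ hβ]
    simp
  simp only [vacuumFunctional_apply, map_mul, Module.End.mul_apply, polyRep_Dgen, polyRep_Egen]
  simpa only [map_sub, map_smul, smul_eq_mul] using congrArg (fun p => ℓ (polyRep q β δ a p)) h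

lemma vacuumFunctional_mul_left (q α β γ δ : ℝ) (ℓ : ℝ[X] →ₗ[ℝ] ℝ) {n : ℕ}
    (h : ∀ k < n, ℓ (leftDefect q α β γ δ (X ^ k)) = 0) (l : List Bool) (hl : l.length < n) :
    α * vacuumFunctional q β δ ℓ (Egen q * word q l)
        - γ * vacuumFunctional q β δ ℓ (Dgen q * word q l)
      = vacuumFunctional q β δ ℓ (word q l) := by
  have h0 := map_eq_zero_of_mem_degreeLT (f := ℓ ∘ₗ leftDefect q α β γ δ) h
    (degreeLT_mono (R := ℝ) hl (polyRep_word_mem q β δ l))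
  simp only [LinearMap.comp_apply, leftDefect, LinearMap.sub_apply, LinearMap.smul_apply, map_sub,
    map_smul, smul_eq_mul, Module.End.one_apply] at h0
  simp only [vacuumFunctional_apply, map_mul, Module.End.mul_apply, polyRep_Dgen, polyRep_Egen]
  linarith

lemma polyRep_Egen_pow (q β δ : ℝ) (n : ℕ) : polyRep q β δ (Egen q ^ n) 1 = X ^ n := by
  induction n with
  | zero => simp
  | succ n ih => rw [pow_succ', map_mul, Module.End.mul_apply, ih, polyRep_Egen, eOp_apply,
      pow_succ']

end Representation

/-! ### From functionals to stationary measures -/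

lemma ofFn_update {L : ℕ} (τ : Fin L → Bool) (k : Fin L) (b : Bool) :
    List.ofFn (Function.update τ k b) = (List.ofFn τ).set k b := by
  refine List.ext_getElem (by simp) fun i h1 h2 => ?_
  simp only [List.getElem_ofFn, List.getElem_set, Function.update_apply, Fin.ext_iff]
  split_ifs <;> first | rfl | omega

lemma exists_eq_append_cons_cons {l : List Bool} {k : ℕ} (hk : k + 1 < l.length) :
    ∃ (u : List Bool) (x y : Bool) (v : List Bool), l = u ++ x :: y :: v ∧ u.length = k :=
  ⟨l.take k, l[k], l[k + 1], l.drop (k + 2), by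
    rw [← List.drop_eq_getElem_cons, ← List.drop_eq_getElem_cons, List.take_append_drop], by
    simp; omega⟩

section Stationary

variable {q α β γ δ : ℝ} {φ : Malg q →ₗ[ℝ] ℝ}

lemma word_bulk (φ : Malg q →ₗ[ℝ] ℝ) (u v : List Bool) :
    φ (word q (u ++ true :: false :: v)) - q * φ (word q (u ++ false :: true :: v))
      = φ (word q (u ++ true :: v)) + φ (word q (u ++ false :: v)) := by
  have h := congrArg (fun a => φ (word q u * (a * word q v))) (Dgen_mul_Egen q)
  simp only [sub_mul, add_mul, mul_sub, mul_add, map_sub, map_add, smul_mul_assoc, mul_smul_comm,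
    map_smul, smul_eq_mul, mul_assoc] at h
  simpa [word_append, word_cons] using h

/-- The occupation sign of site `j` times the weight of the word with that site
erased. -/
def erasedWeight (φ : Malg q →ₗ[ℝ] ℝ) (l : List Bool) (j : ℕ) : ℝ :=
  (indic (l.getD j false) - indic (!l.getD j false)) * φ (word q (l.eraseIdx j))

lemma bulk_term (φ : Malg q →ₗ[ℝ] ℝ) (l : List Bool) (k : ℕ) (hk : k + 1 < l.length) :
    (indic (l.getD (k + 1) false) - indic (l.getD k false)) *
        (φ (word q ((l.set k true).set (k + 1) false))
          - q * φ (word q ((l.set k false).set (k + 1) true)))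
      = erasedWeight φ l (k + 1) - erasedWeight φ l k := by
  obtain ⟨u, x, y, v, rfl, rfl⟩ := exists_eq_append_cons_cons hk
  have hset : ∀ a b, ((u ++ x :: y :: v).set u.length a).set (u.length + 1) b
      = u ++ a :: b :: v := fun a b => by simp
  have he0 : (u ++ x :: y :: v).eraseIdx u.length = u ++ y :: v := by
    simp [List.eraseIdx_append_of_length_le]
  have he1 : (u ++ x :: y :: v).eraseIdx (u.length + 1) = u ++ x :: v := by
    simp [List.eraseIdx_append_of_length_le]
  have hx : (u ++ x :: y :: v).getD u.length false = x := by simp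
  have hy : (u ++ x :: y :: v).getD (u.length + 1) false = y := by
    simp
  rw [erasedWeight, erasedWeight, hset, hset, he0, he1, hx, hy, word_bulk]
  cases x <;> cases y <;> simp [indic] <;> ring

lemma stationary_of_functional {n : ℕ}
    (hleft : ∀ l : List Bool, l.length = n →
      α * φ (Egen q * word q l) - γ * φ (Dgen q * word q l) = φ (word q l))
    (hright : ∀ a, β * φ (a * Dgen q) - δ * φ (a * Egen q) = φ a) :
    ASEPStationary q α β γ δ (n + 1) n.succ_pos fun τ => φ (word q (List.ofFn τ)) := by
  intro τ
  simp only [ofFn_update]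
  have hτ : ∀ (j : ℕ) (hj : j < n + 1), τ ⟨j, hj⟩ = (List.ofFn τ).getD j false := by
    intro j hj
    simp [List.getD_eq_getElem?_getD, hj, -List.ofFn_succ]
  simp only [hτ]
  have hlen : (List.ofFn τ).length = n + 1 := by simp
  generalize List.ofFn τ = l at hlen
  have hsum : (∑ k : Fin (n + 1 - 1),
      (indic (l.getD ((k : ℕ) + 1) false) - indic (l.getD (k : ℕ) false)) *
        (φ (word q ((l.set (k : ℕ) true).set ((k : ℕ) + 1) false))
          - q * φ (word q ((l.set (k : ℕ) false).set ((k : ℕ) + 1) true))))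
      = erasedWeight φ l n - erasedWeight φ l 0 := by
    rw [Nat.add_sub_cancel, ← Finset.sum_range_sub, ← Fin.sum_univ_eq_sum_range
      (fun i => erasedWeight φ l (i + 1) - erasedWeight φ l i)]
    exact Finset.sum_congr rfl fun k _ => bulk_term φ l k (by omega)
  have hfirst : α * φ (word q (l.set 0 false)) - γ * φ (word q (l.set 0 true))
      = φ (word q (l.eraseIdx 0)) := by
    obtain ⟨x, v, rfl⟩ := List.exists_cons_of_length_eq_add_one hlen
    simpa [word_cons] using hleft v (by simpa using hlen)
  have hlast : β * φ (word q (l.set n true)) - δ * φ (word q (l.set n false))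
      = φ (word q (l.eraseIdx n)) := by
    obtain ⟨u, y, rfl⟩ : ∃ u y, l = u ++ [y] :=
      ⟨_, _, (List.dropLast_append_getLast (l := l) (by rintro rfl; simp at hlen)).symm⟩
    have hu : u.length = n := by simpa using hlen
    subst hu
    simpa [List.set_append, List.eraseIdx_append_of_length_le, word_append, word_cons, word_nil]
      using hright (word q u)
  simp only [Nat.add_sub_cancel] at hsum ⊢
  rw [hsum, hfirst, hlast, erasedWeight, erasedWeight]
  ring

lemma ASEPStationary.div_const {L : ℕ} {hL : 0 < L} {P : (Fin L → Bool) → ℝ}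
    (h : ASEPStationary q α β γ δ L hL P) (c : ℝ) :
    ASEPStationary q α β γ δ L hL fun τ => P τ / c := by
  intro τ
  have := congrArg (· / c) (h τ)
  simp only [zero_div, add_div, Finset.sum_div] at this
  rw [← this]
  congr 1
  · congr 1
    · ring
    · exact Finset.sum_congr rfl fun k _ => by ring
  · ring

lemma flip_term {L : ℕ} (P : (Fin L → Bool) → ℝ) (k : Fin L) (τ : Fin L → Bool) (a c : ℝ) :
    (indic (τ k) - indic (!τ k)) *
        (a * P (Function.update τ k false) - c * P (Function.update τ k true))
      = (if flipSite k τ k then c else a) * P (flipSite k τ) - (if τ k then c else a) * P τ := by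
  have hself : Function.update τ k (τ k) = τ := Function.update_eq_self k τ
  cases h : τ k <;> rw [h] at hself <;> simp [flipSite, h, hself, indic]

lemma swap_term {L : ℕ} (P : (Fin L → Bool) → ℝ) (j k : Fin L)
    (τ : Fin L → Bool) (q : ℝ) :
    (indic (τ k) - indic (τ j)) *
        (P (Function.update (Function.update τ j true) k false)
          - q * P (Function.update (Function.update τ j false) k true))
      = (if swapSites j k τ j then 1 else q) * P (swapSites j k τ)
        - (if τ j then 1 else q) * P τ := by
  by_cases h : τ j = τ k
  · rw [swapSites_of_eq h, h]; ring
  · have hself : Function.update (Function.update τ j (τ j)) k (τ k) = τ := by simp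
    have hs : swapSites j k τ j = τ k := by simp [swapSites]
    rw [hs, swapSites_eq_update]
    cases hj : τ j <;> cases hk : τ k <;> rw [hj, hk] at h hself <;>
      first
      | exact absurd rfl h
      | (simp only [hself, indic]; simp)

/-- A solution of the stationarity equations has constant sign. -/
lemma ASEPStationary.nonpos_or_pos (hq : 0 < q) (hα : 0 < α) (hβ : 0 < β) (hγ : 0 < γ)
    (hδ : 0 < δ) {L : ℕ} {hL : 0 < L} {P : (Fin L → Bool) → ℝ}
    (h : ASEPStationary q α β γ δ L hL P) : (∀ τ, P τ ≤ 0) ∨ (∀ τ, 0 < P τ) := by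
  let first : Fin L := ⟨0, hL⟩
  let last : Fin L := ⟨L - 1, Nat.sub_lt hL Nat.one_pos⟩
  let s (k : Fin (L - 1)) : Fin L :=
    ⟨(k : ℕ), Nat.lt_of_succ_lt (Nat.add_lt_of_lt_sub k.isLt)⟩
  let s' (k : Fin (L - 1)) : Fin L := ⟨(k : ℕ) + 1, Nat.add_lt_of_lt_sub k.isLt⟩
  let m : Option (Option (Fin (L - 1))) → (Fin L → Bool) → (Fin L → Bool)
    | none => flipSite first
    | some none => flipSite last
    | some (some k) => swapSites (s k) (s' k)
  let r : Option (Option (Fin (L - 1))) → (Fin L → Bool) → ℝ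
    | none => fun τ => if τ first then γ else α
    | some none => fun τ => if τ last then β else δ
    | some (some k) => fun τ => if τ (s k) then 1 else q
  refine balance_nonpos_or_pos m ?_ r ?_ ?_ P ?_
  · rintro (_ | _ | k)
    · exact flipSite_involutive _
    · exact flipSite_involutive _
    · exact swapSites_involutive _ _
  · rintro (_ | _ | k) τ <;> simp only [r] <;> split_ifs <;> first | assumption | exact one_pos
  · intro S hS hmove
    refine eq_univ_of_moves hL S hS (hmove none) fun k hk => ?_
    exact hmove (some (some ⟨k, Nat.lt_sub_of_add_lt hk⟩))
  · intro τ
    rw [← sub_eq_zero, ← h τ, ← Finset.sum_sub_distrib, Fintype.sum_option, Fintype.sum_option]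
    have hlast := flip_term P last τ δ β
    have hfirst := flip_term P first τ α γ
    have hswap := Finset.sum_congr (rfl : (Finset.univ : Finset (Fin (L - 1))) = _)
      fun k _ => swap_term P (s k) (s' k) τ q
    simp only [m, r]
    rw [← hlast, ← hfirst, ← hswap]
    ring

lemma sum_word_ofFn (q : ℝ) (L : ℕ) :
    ∑ τ : Fin L → Bool, word q (List.ofFn τ) = (Dgen q + Egen q) ^ L := by
  induction L with
  | zero => simp [word_nil]
  | succ n ih =>
    rw [← (Fin.consEquiv fun _ => Bool).sum_comp, Fintype.sum_prod_type, pow_succ', ← ih]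
    simp [Fin.consEquiv, List.ofFn_succ, word_cons, ← Finset.mul_sum, add_mul]

lemma Pfun_eq (φ : Malg q →ₗ[ℝ] ℝ) (L : ℕ) :
    Pfun q φ L = fun τ => φ (word q (List.ofFn τ)) / φ ((Dgen q + Egen q) ^ L) := by
  ext τ
  simp [Pfun, word, List.map_ofFn, Function.comp_def]

lemma word_eq_zero_of_le {m L : ℕ} (hmL : m ≤ L)
    (hleft : ∀ l : List Bool, l.length < L →
      α * φ (Egen q * word q l) - γ * φ (Dgen q * word q l) = φ (word q l))
    (h0 : ∀ l : List Bool, l.length = L → φ (word q l) = 0) :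
    ∀ l : List Bool, l.length = m → φ (word q l) = 0 := by
  induction hmL with
  | refl => exact h0
  | @step L _ ih =>
    refine ih (fun l hl => hleft l (hl.trans L.lt_succ_self)) fun l hl => ?_
    have hE := h0 (false :: l) (by simp [hl])
    have hD := h0 (true :: l) (by simp [hl])
    have := hleft l (by omega)
    simp only [word_cons, if_true, Bool.false_eq_true, if_false] at hE hD
    rw [hE, hD] at this
    simpa using this.symm

/-- A functional satisfying the boundary relations up to length `L`, which does not vanish on
some word of length at most `L`, yields the stationary measure of the system of size `L`. -/
lemma Pfun_stationary (hq : 0 < q) (hα : 0 < α) (hβ : 0 < β) (hγ : 0 < γ) (hδ : 0 < δ)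
    {m L : ℕ} (hL : 0 < L) (hmL : m ≤ L)
    (hleft : ∀ l : List Bool, l.length < L →
      α * φ (Egen q * word q l) - γ * φ (Dgen q * word q l) = φ (word q l))
    (hright : ∀ a, β * φ (a * Dgen q) - δ * φ (a * Egen q) = φ a)
    (hne : ∃ l : List Bool, l.length = m ∧ φ (word q l) ≠ 0) :
    φ ((Dgen q + Egen q) ^ L) ≠ 0 ∧ (∀ τ : Fin L → Bool, 0 ≤ Pfun q φ L τ) ∧
      (∑ τ : Fin L → Bool, Pfun q φ L τ) = 1 ∧
      ASEPStationary q α β γ δ L hL (Pfun q φ L) := by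
  obtain ⟨n, rfl⟩ : ∃ n, L = n + 1 := ⟨L - 1, by omega⟩
  have hstat : ASEPStationary q α β γ δ (n + 1) hL fun τ => φ (word q (List.ofFn τ)) :=
    stationary_of_functional (fun l hl => hleft l (by omega)) hright
  have hsum : φ ((Dgen q + Egen q) ^ (n + 1))
      = ∑ τ : Fin (n + 1) → Bool, φ (word q (List.ofFn τ)) := by
    rw [← sum_word_ofFn, map_sum]
  have hsign := hstat.nonpos_or_pos hq hα hβ hγ hδ
  have hZ : φ ((Dgen q + Egen q) ^ (n + 1)) ≠ 0 := by
    intro hZ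
    rw [hsum] at hZ
    have hzero : ∀ τ : Fin (n + 1) → Bool, φ (word q (List.ofFn τ)) = 0 := by
      rcases hsign with h | h
      · exact fun τ => (Finset.sum_eq_zero_iff_of_nonpos fun τ _ => h τ).mp hZ τ
          (Finset.mem_univ τ)
      · exact absurd hZ (Finset.sum_pos (fun τ _ => h τ) Finset.univ_nonempty).ne'
    obtain ⟨l, hl, hφ⟩ := hne
    refine hφ (word_eq_zero_of_le hmL hleft (fun l hl => ?_) l hl)
    subst_vars
    have := hzero fun i => l.get (i.cast hl.symm)
    rwa [show List.ofFn (fun i => l.get (i.cast hl.symm)) = l from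
      List.ext_getElem (by simp [hl]) (by simp [-List.ofFn_succ])] at this
  rw [Pfun_eq]
  refine ⟨hZ, fun τ => ?_, ?_, hstat.div_const _⟩
  · rcases hsign with h | h
    · refine div_nonneg_of_nonpos (h τ) ?_
      rw [hsum]
      exact Finset.sum_nonpos fun τ _ => h τ
    · refine div_nonneg (h τ).le ?_
      rw [hsum]
      exact Finset.sum_nonneg fun τ _ => (h τ).le
  · rw [← Finset.sum_div, ← hsum, div_self hZ]

end Stationary

/-! ### The Bernoulli product measure -/

lemma prod_apply_update {L : ℕ} (F : Fin L → Bool → ℝ) (s : Finset (Fin L)) (τ : Fin L → Bool)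
    {k : Fin L} (hk : k ∈ s) (b : Bool) :
    ∏ i ∈ s, F i (Function.update τ k b i) = F k b * ∏ i ∈ s.erase k, F i (τ i) := by
  rw [← Finset.mul_prod_erase s _ hk, Function.update_self]
  congr 1
  exact Finset.prod_congr rfl fun i hi => by
    rw [Function.update_of_ne (Finset.ne_of_mem_erase hi)]

/-- The one-site marginals of the Bernoulli measure. -/
def siteWeight (q α γ : ℝ) (j : ℕ) (b : Bool) : ℝ :=
  if b then α / (α + γ * q ^ j) else 1 - α / (α + γ * q ^ j)

section Bernoulli

variable {q α γ : ℝ}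

lemma siteWeight_false (hq : 0 < q) (hα : 0 < α) (hγ : 0 < γ) (j : ℕ) :
    siteWeight q α γ j false = γ * q ^ j / (α + γ * q ^ j) := by
  have : α + γ * q ^ j ≠ 0 := by positivity
  simp only [siteWeight, Bool.false_eq_true, if_false]
  field_simp
  ring

lemma siteWeight_pos (hq : 0 < q) (hα : 0 < α) (hγ : 0 < γ) (j : ℕ) (b : Bool) :
    0 < siteWeight q α γ j b := by
  cases b
  · rw [siteWeight_false hq hα hγ]; positivity
  · simp only [siteWeight, if_true]; positivity

lemma siteWeight_first (hq : 0 < q) (hα : 0 < α) (hγ : 0 < γ) :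
    α * siteWeight q α γ 0 false = γ * siteWeight q α γ 0 true := by
  rw [siteWeight_false hq hα hγ]
  simp only [siteWeight, if_true]
  ring

lemma siteWeight_swap (hq : 0 < q) (hα : 0 < α) (hγ : 0 < γ) (k : ℕ) :
    siteWeight q α γ k true * siteWeight q α γ (k + 1) false
      = q * (siteWeight q α γ k false * siteWeight q α γ (k + 1) true) := by
  rw [siteWeight_false hq hα hγ, siteWeight_false hq hα hγ]
  simp only [siteWeight, if_true]
  ring

lemma sum_prod_siteWeight (q α γ : ℝ) (L : ℕ) :
    ∑ τ : Fin L → Bool, ∏ j : Fin L, siteWeight q α γ j (τ j) = 1 := by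
  rw [← Fintype.prod_sum fun (j : Fin L) b => siteWeight q α γ j b]
  simp [siteWeight]

/-- A normalized weight satisfying detailed balance in the bulk and at the left boundary is the
Bernoulli product measure. -/
lemma eq_prod_siteWeight (hq : 0 < q) (hα : 0 < α) (hγ : 0 < γ) {L : ℕ} (hL : 0 < L)
    (f : (Fin L → Bool) → ℝ) (hsum : ∑ τ, f τ = 1)
    (hfirst : ∀ τ, α * f (Function.update τ ⟨0, hL⟩ false)
      = γ * f (Function.update τ ⟨0, hL⟩ true))
    (hbulk : ∀ (k : ℕ) (hk : k + 1 < L) (τ : Fin L → Bool),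
      f (Function.update (Function.update τ ⟨k, Nat.lt_of_succ_lt hk⟩ true) ⟨k + 1, hk⟩ false)
        = q * f (Function.update (Function.update τ ⟨k, Nat.lt_of_succ_lt hk⟩ false)
            ⟨k + 1, hk⟩ true)) (τ : Fin L → Bool) :
    f τ = ∏ j : Fin L, siteWeight q α γ j (τ j) := by
  set B : (Fin L → Bool) → ℝ := fun τ => ∏ j : Fin L, siteWeight q α γ j (τ j) with hB
  have hBpos : ∀ τ, 0 < B τ := fun τ => Finset.prod_pos fun j _ => siteWeight_pos hq hα hγ _ _
  have hBfirst : ∀ τ, α * B (Function.update τ ⟨0, hL⟩ false)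
      = γ * B (Function.update τ ⟨0, hL⟩ true) := fun τ => by
    simp only [hB]
    rw [prod_apply_update (fun j : Fin L => siteWeight q α γ j) _ _ (Finset.mem_univ _),
      prod_apply_update (fun j : Fin L => siteWeight q α γ j) _ _ (Finset.mem_univ _),
      ← mul_assoc, ← mul_assoc, siteWeight_first hq hα hγ]
  have hBbulk : ∀ (k : ℕ) (hk : k + 1 < L) (τ : Fin L → Bool),
      B (Function.update (Function.update τ ⟨k, Nat.lt_of_succ_lt hk⟩ true) ⟨k + 1, hk⟩ false)
        = q * B (Function.update (Function.update τ ⟨k, Nat.lt_of_succ_lt hk⟩ false)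
            ⟨k + 1, hk⟩ true) := fun k hk τ => by
    have hmem : (⟨k, Nat.lt_of_succ_lt hk⟩ : Fin L) ∈ Finset.univ.erase ⟨k + 1, hk⟩ := by
      simp [Fin.ext_iff]
    have h : ∀ a b, B (Function.update (Function.update τ ⟨k, Nat.lt_of_succ_lt hk⟩ a)
        ⟨k + 1, hk⟩ b) = siteWeight q α γ k a * siteWeight q α γ (k + 1) b *
          ∏ j ∈ (Finset.univ.erase ⟨k + 1, hk⟩).erase ⟨k, Nat.lt_of_succ_lt hk⟩,
            siteWeight q α γ (j : Fin L) (τ j) := fun a b => by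
      simp only [hB]
      rw [prod_apply_update (fun j : Fin L => siteWeight q α γ j) _ _ (Finset.mem_univ _),
        prod_apply_update (fun j : Fin L => siteWeight q α γ j) _ _ hmem]
      ring
    rw [h, h, siteWeight_swap hq hα hγ]
    ring
  let c : ℝ := f τ / B τ
  have huniv : {σ | f σ = c * B σ} = Set.univ := by
    refine eq_univ_of_moves hL _ ⟨τ, (div_mul_cancel₀ _ (hBpos τ).ne').symm⟩ ?_ ?_
    · intro σ (hσ : f σ = c * B σ)
      change f (flipSite _ σ) = c * B (flipSite _ σ)
      have h1 := hfirst σ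
      have h2 := hBfirst σ
      have hself := Function.update_eq_self (⟨0, hL⟩ : Fin L) σ
      rw [flipSite]
      cases hσ0 : σ ⟨0, hL⟩ <;> rw [hσ0] at hself <;> rw [hself] at h1 h2 <;>
        simp only [Bool.not_true, Bool.not_false]
      · refine mul_left_cancel₀ hγ.ne' ?_
        rw [← h1, hσ, mul_left_comm, h2, mul_left_comm]
      · refine mul_left_cancel₀ hα.ne' ?_
        rw [h1, hσ, mul_left_comm, ← h2, mul_left_comm]
    · intro k hk σ (hσ : f σ = c * B σ)
      change f (swapSites _ _ σ) = c * B (swapSites _ _ σ)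
      by_cases h : σ ⟨k, Nat.lt_of_succ_lt hk⟩ = σ ⟨k + 1, hk⟩
      · rwa [swapSites_of_eq h]
      have h1 := hbulk k hk σ
      have h2 := hBbulk k hk σ
      have hself : Function.update (Function.update σ ⟨k, Nat.lt_of_succ_lt hk⟩
          (σ ⟨k, Nat.lt_of_succ_lt hk⟩)) ⟨k + 1, hk⟩ (σ ⟨k + 1, hk⟩) = σ := by simp
      rw [swapSites_eq_update]
      cases hj : σ ⟨k, Nat.lt_of_succ_lt hk⟩ <;> cases hk' : σ ⟨k + 1, hk⟩ <;>
        rw [hj, hk'] at h hself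
      · exact absurd rfl h
      · rw [hself] at h1 h2
        rw [h1, h2, hσ, mul_left_comm]
      · rw [hself] at h1 h2
        refine mul_left_cancel₀ hq.ne' ?_
        rw [← h1, hσ, mul_left_comm, ← h2]
      · exact absurd rfl h
  have hall : ∀ σ, f σ = c * B σ := fun σ => (Set.ext_iff.mp huniv σ).mpr trivial
  have hc : c = 1 := by
    rw [Finset.sum_congr rfl fun σ _ => hall σ, ← Finset.mul_sum, hB, sum_prod_siteWeight,
      mul_one] at hsum
    exact hsum
  rw [hall τ, hc, one_mul]

end Bernoulli

/-- If the functional vanishes on words of length `N`, its weights of length `N + 1` form the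
Bernoulli product measure. -/
lemma Pfun_eq_prod_siteWeight {q α γ : ℝ} {φ : Malg q →ₗ[ℝ] ℝ} (hq : 0 < q) (hα : 0 < α)
    (hγ : 0 < γ) {N : ℕ}
    (hleft : ∀ l : List Bool, l.length = N →
      α * φ (Egen q * word q l) - γ * φ (Dgen q * word q l) = φ (word q l))
    (hzero : ∀ l : List Bool, l.length = N → φ (word q l) = 0)
    (hsum : ∑ τ : Fin (N + 1) → Bool, Pfun q φ (N + 1) τ = 1) (τ : Fin (N + 1) → Bool) :
    Pfun q φ (N + 1) τ = ∏ j : Fin (N + 1), siteWeight q α γ j (τ j) := by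
  refine eq_prod_siteWeight hq hα hγ N.succ_pos _ hsum (fun τ => ?_) (fun k hk τ => ?_) τ
  · simp only [Pfun_eq, ofFn_update, ← mul_div_assoc]
    congr 1
    have hlen : (List.ofFn τ).length = N + 1 := by simp
    generalize List.ofFn τ = l at hlen
    obtain ⟨x, v, rfl⟩ := List.exists_cons_of_length_eq_add_one hlen
    have hv : v.length = N := by simpa using hlen
    have := hleft v hv
    rw [hzero v hv] at this
    simpa [word_cons] using sub_eq_zero.mp this
  · simp only [Pfun_eq, ofFn_update, ← mul_div_assoc]
    congr 1
    have hlen : (List.ofFn τ).length = N + 1 := by simp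
    generalize List.ofFn τ = l at hlen
    obtain ⟨u, x, y, v, rfl, rfl⟩ := exists_eq_append_cons_cons (l := l) (k := k) (by omega)
    have hlen' : u.length + (v.length + 1) = N := by simp at hlen; omega
    have h := word_bulk φ u v
    rw [hzero (u ++ true :: v) (by simpa using hlen'),
      hzero (u ++ false :: v) (by simpa using hlen'), add_zero] at h
    simpa using sub_eq_zero.mp h

theorem stmt0 (q α β γ δ : ℝ) (N : ℕ) (hq0 : 0 < q) (hq1 : q < 1)
    (hα : 0 < α) (hβ : 0 < β) (hγ : 0 < γ) (hδ : 0 < δ)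
    (hsing : α * β = q ^ N * γ * δ) :
    ∃ φ₀ φ₁ : Malg q →ₗ[ℝ] ℝ,
      (∀ (L : ℕ) (hL : 0 < L), L ≤ N →
        φ₀ ((Dgen q + Egen q) ^ L) ≠ 0 ∧
        (∀ τ : Fin L → Bool, 0 ≤ Pfun q φ₀ L τ) ∧
        (∑ τ : Fin L → Bool, Pfun q φ₀ L τ) = 1 ∧
        ASEPStationary q α β γ δ L hL (Pfun q φ₀ L)) ∧
      (∀ (L : ℕ) (hL : N + 1 ≤ L),
        φ₁ ((Dgen q + Egen q) ^ L) ≠ 0 ∧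
        (∀ τ : Fin L → Bool, 0 ≤ Pfun q φ₁ L τ) ∧
        (∑ τ : Fin L → Bool, Pfun q φ₁ L τ) = 1 ∧
        ASEPStationary q α β γ δ L (Nat.lt_of_lt_of_le (Nat.succ_pos N) hL) (Pfun q φ₁ L)) ∧
      (∀ τ : Fin (N + 1) → Bool,
        Pfun q φ₁ (N + 1) τ =
          ∏ j : Fin (N + 1),
            (if τ j then α / (α + γ * q ^ (j : ℕ))
              else 1 - α / (α + γ * q ^ (j : ℕ)))) := by
  have hne : ∀ k, k ≠ N → α * β ≠ q ^ k * γ * δ := fun k hk h => hk <| by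
    rw [hsing, mul_assoc, mul_assoc] at h
    exact (pow_right_injective₀ hq0 hq1.ne (mul_right_cancel₀ (mul_pos hγ hδ).ne' h)).symm
  obtain ⟨ℓ₀, -, h₀, h₀'⟩ := exists_linear_functional q α β γ δ hβ.ne' 0
  obtain ⟨ℓ₁, h₁, h₁m, h₁'⟩ := exists_linear_functional q α β γ δ hβ.ne' (N + 1)
  have hdefect : ∀ k, ℓ₁ (leftDefect q α β γ δ (Polynomial.X ^ k)) = 0 := by
    intro k
    rcases lt_or_ge N k with hk | hk
    · exact h₁' k hk (hne k hk.ne')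
    have hrem := map_eq_zero_of_mem_degreeLT h₁
      (Polynomial.degreeLT_mono (R := ℝ) (Nat.succ_le_succ hk) (leftDefect_sub_mem q α β γ δ k))
    rw [map_sub, sub_eq_zero, ← Polynomial.smul_eq_C_mul, map_smul, smul_eq_mul] at hrem
    rw [hrem]
    rcases hk.lt_or_eq with hk | rfl
    · rw [h₁ _ (Nat.succ_lt_succ hk), mul_zero]
    · have hc : α - γ * (q ^ k * δ / β) = 0 := by
        field_simp
        linarith
      rw [hc, zero_mul]
  have hleft₁ : ∀ l : List Bool, α * vacuumFunctional q β δ ℓ₁ (Egen q * word q l)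
      - γ * vacuumFunctional q β δ ℓ₁ (Dgen q * word q l)
      = vacuumFunctional q β δ ℓ₁ (word q l) := fun l =>
    vacuumFunctional_mul_left q α β γ δ ℓ₁ (fun k _ => hdefect k) l l.length.lt_succ_self
  have hmain : ∀ (L : ℕ) (hL : N + 1 ≤ L), _ := fun L hL =>
    Pfun_stationary hq0 hα hβ hγ hδ (Nat.lt_of_lt_of_le (Nat.succ_pos N) hL) hL
      (fun l _ => hleft₁ l) (vacuumFunctional_mul_right q β δ hβ.ne' ℓ₁)
      ⟨List.replicate (N + 1) false, by simp, by
        have hword : word q (List.replicate (N + 1) false) = Egen q ^ (N + 1) := by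
          rw [word, List.map_replicate, List.prod_replicate, if_neg Bool.false_ne_true]
        rw [hword, vacuumFunctional_apply, polyRep_Egen_pow, h₁m]
        exact one_ne_zero⟩
  refine ⟨vacuumFunctional q β δ ℓ₀, vacuumFunctional q β δ ℓ₁, fun L hL hLN => ?_, hmain,
    fun τ => ?_⟩
  · refine Pfun_stationary hq0 hα hβ hγ hδ hL (Nat.zero_le L) (fun l hl => ?_)
      (vacuumFunctional_mul_right q β δ hβ.ne' ℓ₀) ⟨[], rfl, ?_⟩
    · exact vacuumFunctional_mul_left q α β γ δ ℓ₀ (n := N)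
        (fun k hk => h₀' k (Nat.zero_le k) (hne k hk.ne)) l (hl.trans_le hLN)
    · rw [pow_zero] at h₀
      simp [word_nil, vacuumFunctional_apply, h₀]
  · refine Pfun_eq_prod_siteWeight hq0 hα hγ (fun l _ => hleft₁ l) (fun l hl => ?_)
      (hmain (N + 1) le_rfl).2.2.1 τ
    exact map_eq_zero_of_mem_degreeLT h₁ (hl ▸ polyRep_word_mem q β δ l)

end
end

section
/- Let 0 ≤ q < 1, let α, β > 0 and γ, δ ≥ 0, and suppose α·β ≠ q^n·γ·δ for every n ∈ ℕ. Then there exists an ℝ-linear functional φ₀ : ℳ → ℝ such that for every integer L ≥ 1: φ₀((𝐃+𝐄)^L) ≠ 0, and the function P : {0,1}^L → ℝ defined by P(τ₁,…,τ_L) = φ₀(∏_{j=1}^{L}(τ_j·𝐃 + (1−τ_j)·𝐄)) / φ₀((𝐃+𝐄)^L) is nonnegative, sums to 1 over {0,1}^L, and satisfies the ASEP stationarity equations with parameters (α,β,γ,δ,q). -/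
noncomputable section

open scoped BigOperators

namespace ASEP

open Polynomial

/-! ### A representation of `ℳ` on polynomials -/

/-- The image of `X ^ n` under the action of `𝐃` on `ℝ[X]`, where `𝐄` acts as multiplication
by `X` and the constant polynomial `1` is fixed by `β 𝐃 - δ 𝐄`. -/
def actDMonomial (q β δ : ℝ) : ℕ → ℝ[X]
  | 0 => C (δ / β) * X + C (1 / β)
  | n + 1 => (C q * X + 1) * actDMonomial q β δ n + X ^ (n + 1)

/-- The action of `𝐃` on `ℝ[X]`. -/
def actD (q β δ : ℝ) : Module.End ℝ ℝ[X] :=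
  (basisMonomials ℝ).constr ℝ (actDMonomial q β δ)

/-- The action of `𝐄` on `ℝ[X]`, namely multiplication by `X`. -/
def actE : Module.End ℝ ℝ[X] := LinearMap.mulLeft ℝ X

lemma actE_apply (p : ℝ[X]) : actE p = X * p := rfl

lemma actD_monomial (q β δ : ℝ) (n : ℕ) (c : ℝ) :
    actD q β δ (monomial n c) = c • actDMonomial q β δ n := by
  have h := (basisMonomials ℝ).constr_basis ℝ (actDMonomial q β δ) n
  rw [coe_basisMonomials] at h
  have hm : (monomial n c : ℝ[X]) = c • monomial n 1 := by simp [smul_monomial]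
  rw [hm, map_smul, actD, h]

lemma actD_mul_actE (q β δ : ℝ) :
    actD q β δ * actE - q • (actE * actD q β δ) = actD q β δ + actE := by
  refine lhom_ext' fun n => LinearMap.ext_ring ?_
  have hX : (X : ℝ[X]) * monomial n 1 = monomial (n + 1) 1 := X_mul_monomial n 1
  simp only [LinearMap.comp_apply, LinearMap.sub_apply, LinearMap.add_apply, LinearMap.smul_apply,
    Module.End.mul_apply, actE_apply, hX, actD_monomial, one_smul, actDMonomial]
  rw [smul_eq_C_mul, monomial_one_right_eq_X_pow]
  ring

lemma coeff_actDMonomial_eq_zero (q β δ : ℝ) (n m : ℕ) (h : n + 1 < m) :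
    (actDMonomial q β δ n).coeff m = 0 := by
  induction n generalizing m with
  | zero =>
    obtain ⟨m, rfl⟩ : ∃ k, m = k + 2 := ⟨m - 2, by omega⟩
    simp [actDMonomial]
  | succ n ih =>
    obtain ⟨m, rfl⟩ : ∃ k, m = k + 1 := ⟨m - 1, by omega⟩
    rw [actDMonomial, add_mul, mul_assoc, one_mul, coeff_add, coeff_add, coeff_C_mul, coeff_X_mul,
      ih _ (by omega), ih _ (by omega), coeff_X_pow, if_neg (by omega)]
    simp

lemma coeff_actDMonomial_succ (q β δ : ℝ) (n : ℕ) :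
    (actDMonomial q β δ n).coeff (n + 1) = q ^ n * (δ / β) := by
  induction n with
  | zero => simp [actDMonomial, coeff_C]
  | succ n ih =>
    rw [actDMonomial, add_mul, mul_assoc, one_mul, coeff_add, coeff_add, coeff_C_mul, coeff_X_mul,
      ih, coeff_actDMonomial_eq_zero _ _ _ _ _ (by omega), coeff_X_pow, if_neg (by omega)]
    ring

lemma coeff_actD_natDegree_succ (q β δ : ℝ) (p : ℝ[X]) :
    (actD q β δ p).coeff (p.natDegree + 1) = p.leadingCoeff * (q ^ p.natDegree * (δ / β)) := by
  have hs := congrArg (fun r => (actD q β δ r).coeff (p.natDegree + 1)) p.as_sum_range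
  rw [hs, map_sum, finsetSum_coeff, Finset.sum_range_succ, Finset.sum_eq_zero]
  · rw [actD_monomial, coeff_smul, coeff_actDMonomial_succ, zero_add, smul_eq_mul, leadingCoeff]
  · intro i hi
    rw [Finset.mem_range] at hi
    rw [actD_monomial, coeff_smul, coeff_actDMonomial_eq_zero _ _ _ _ _ (by omega), smul_zero]

/-- The action of `ℳ` on `ℝ[X]`. -/
def rep (q β δ : ℝ) : Malg q →ₐ[ℝ] Module.End ℝ ℝ[X] :=
  RingQuot.liftAlgHom ℝ ⟨FreeAlgebra.lift ℝ ![actD q β δ, actE], by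
    rintro _ _ ⟨⟩
    simpa using actD_mul_actE q β δ⟩

lemma rep_Dgen (q β δ : ℝ) : rep q β δ (Dgen q) = actD q β δ := by
  simp [rep, Dgen]

lemma rep_Egen (q β δ : ℝ) : rep q β δ (Egen q) = actE := by
  simp [rep, Egen]

lemma Dgen_mul_Egen (q : ℝ) :
    Dgen q * Egen q - q • (Egen q * Dgen q) = Dgen q + Egen q := by
  simpa [Dgen, Egen] using RingQuot.mkAlgHom_rel ℝ (ASEPrel.rel (q := q))

/-- A linear functional on `ℝ[X]` that is invariant under `α 𝐄 - γ 𝐃`. -/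
lemma exists_invariant_functional {q α β γ δ : ℝ} (hβ : 0 < β)
    (hns : ∀ n : ℕ, α * β ≠ q ^ n * γ * δ) :
    ∃ ψ : ℝ[X] →ₗ[ℝ] ℝ, ψ 1 = 1 ∧ ∀ p, α * ψ (X * p) - γ * ψ (actD q β δ p) = ψ p := by
  let T : Module.End ℝ ℝ[X] := α • actE - γ • actD q β δ - 1
  have h1 : (1 : ℝ[X]) ∉ LinearMap.range T := by
    rintro ⟨p, hp⟩
    have hp0 : p ≠ 0 := by
      rintro rfl
      simp at hp
    have hc := congrArg (coeff · (p.natDegree + 1)) hp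
    simp only [T, LinearMap.sub_apply, LinearMap.smul_apply, Module.End.one_apply, actE_apply,
      coeff_sub, coeff_smul, coeff_X_mul, coeff_actD_natDegree_succ, coeff_natDegree,
      coeff_natDegree_succ_eq_zero, coeff_one, smul_eq_mul] at hc
    rw [if_neg (by omega)] at hc
    have hl : p.leadingCoeff ≠ 0 := leadingCoeff_ne_zero.mpr hp0
    have hz : p.leadingCoeff * (α * β - q ^ p.natDegree * γ * δ) = 0 := by
      field_simp at hc
      linear_combination hc
    rcases mul_eq_zero.mp hz with h | h
    · exact hl h
    · exact hns _ (sub_eq_zero.mp h)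
  obtain ⟨f, hf1, hf⟩ := Submodule.exists_le_ker_of_notMem h1
  refine ⟨(f 1)⁻¹ • f, by simp [hf1], fun p => ?_⟩
  have hTp : f (T p) = 0 := hf ⟨p, rfl⟩
  simp only [T, LinearMap.sub_apply, LinearMap.smul_apply, Module.End.one_apply, actE_apply,
    map_sub, map_smul, smul_eq_mul] at hTp ⊢
  linear_combination (f 1)⁻¹ * hTp

/-- The functional of the matrix product ansatz. -/
lemma exists_ansatz_functional {q α β γ δ : ℝ} (hβ : 0 < β)
    (hns : ∀ n : ℕ, α * β ≠ q ^ n * γ * δ) :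
    ∃ φ : Malg q →ₗ[ℝ] ℝ, φ 1 = 1 ∧
      (∀ A, α * φ (Egen q * A) - γ * φ (Dgen q * A) = φ A) ∧
      ∀ A, β * φ (A * Dgen q) - δ * φ (A * Egen q) = φ A := by
  obtain ⟨ψ, hψ1, hψ⟩ := exists_invariant_functional hβ hns
  refine ⟨ψ ∘ₗ LinearMap.applyₗ 1 ∘ₗ (rep q β δ).toLinearMap, by simp [hψ1], fun A => ?_,
    fun A => ?_⟩
  · simpa [rep_Dgen, rep_Egen, actE_apply] using hψ (rep q β δ A 1)
  · have hD : actD q β δ 1 = C (δ / β) * X + C (1 / β) := by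
      simpa [actDMonomial] using actD_monomial q β δ 0 1
    have h1 : β • actD q β δ 1 - δ • actE 1 = 1 := by
      rw [hD, actE_apply, smul_eq_C_mul, smul_eq_C_mul, mul_add, ← mul_assoc, ← C_mul, ← C_mul,
        mul_div_cancel₀ _ hβ.ne', mul_div_cancel₀ _ hβ.ne', C_1]
      ring
    have h2 := congrArg (fun p => ψ (rep q β δ A p)) h1
    simpa [rep_Dgen, rep_Egen] using h2

/-! ### The generator of the process -/

/-- The forward generator of the ASEP, acting on functions on `{0,1}^L`. -/
def generator (q α β γ δ : ℝ) (L : ℕ) (hL : 0 < L) (P : (Fin L → Bool) → ℝ)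
    (τ : Fin L → Bool) : ℝ :=
    (indic (τ ⟨0, hL⟩) - indic (!τ ⟨0, hL⟩)) *
        (α * P (Function.update τ ⟨0, hL⟩ false) - γ * P (Function.update τ ⟨0, hL⟩ true))
      + (∑ k : Fin (L - 1),
          (indic (τ ⟨(k : ℕ) + 1, Nat.add_lt_of_lt_sub k.isLt⟩)
              - indic (τ ⟨(k : ℕ), Nat.lt_of_succ_lt (Nat.add_lt_of_lt_sub k.isLt)⟩)) *
            (P (Function.update (Function.update τ
                  ⟨(k : ℕ), Nat.lt_of_succ_lt (Nat.add_lt_of_lt_sub k.isLt)⟩ true)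
                  ⟨(k : ℕ) + 1, Nat.add_lt_of_lt_sub k.isLt⟩ false)
              - q * P (Function.update (Function.update τ
                  ⟨(k : ℕ), Nat.lt_of_succ_lt (Nat.add_lt_of_lt_sub k.isLt)⟩ false)
                  ⟨(k : ℕ) + 1, Nat.add_lt_of_lt_sub k.isLt⟩ true)))
      + (indic (!τ ⟨L - 1, Nat.sub_lt hL Nat.one_pos⟩)
            - indic (τ ⟨L - 1, Nat.sub_lt hL Nat.one_pos⟩)) *
          (β * P (Function.update τ ⟨L - 1, Nat.sub_lt hL Nat.one_pos⟩ true)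
            - δ * P (Function.update τ ⟨L - 1, Nat.sub_lt hL Nat.one_pos⟩ false))

variable {q α β γ δ : ℝ} {L : ℕ} {hL : 0 < L}

lemma generator_add (P Q : (Fin L → Bool) → ℝ) (τ : Fin L → Bool) :
    generator q α β γ δ L hL (P + Q) τ =
      generator q α β γ δ L hL P τ + generator q α β γ δ L hL Q τ := by
  simp only [generator, Pi.add_apply]
  rw [Finset.sum_congr rfl fun k _ => show _ = _ + _ by rw [mul_add, add_sub_add_comm, mul_add],
    Finset.sum_add_distrib]
  ring

lemma generator_smul (c : ℝ) (P : (Fin L → Bool) → ℝ) (τ : Fin L → Bool) :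
    generator q α β γ δ L hL (c • P) τ = c * generator q α β γ δ L hL P τ := by
  simp only [generator, Pi.smul_apply, smul_eq_mul, mul_add, Finset.mul_sum]
  refine congrArg₂ _ (congrArg₂ _ (by ring) (Finset.sum_congr rfl fun k _ => by ring)) (by ring)

lemma sum_eq_zero_of_antisymm {ι : Type*} [Fintype ι] (f : ι → ℝ) (σ : ι ≃ ι)
    (h : ∀ i, f (σ i) = -f i) : ∑ i, f i = 0 := by
  have h1 := Equiv.sum_comp σ f
  simp only [h, Finset.sum_neg_distrib] at h1
  linarith

lemma indic_not (b : Bool) : indic (!b) = 1 - indic b := by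
  cases b <;> simp [indic]

/-- Flipping the occupation of one site. -/
def flip {ι : Type*} [DecidableEq ι] (i : ι) : (ι → Bool) ≃ (ι → Bool) :=
  Function.Involutive.toPerm (fun τ => Function.update τ i (!τ i)) fun τ => by simp

lemma flip_apply {ι : Type*} [DecidableEq ι] (i : ι) (τ : ι → Bool) :
    flip i τ = Function.update τ i (!τ i) := rfl

lemma sum_generator (P : (Fin L → Bool) → ℝ) :
    ∑ τ, generator q α β γ δ L hL P τ = 0 := by
  simp only [generator, Finset.sum_add_distrib]
  rw [Finset.sum_comm, sum_eq_zero_of_antisymm _ (flip ⟨0, hL⟩),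
    sum_eq_zero_of_antisymm _ (flip ⟨L - 1, Nat.sub_lt hL Nat.one_pos⟩),
    Finset.sum_eq_zero]
  · simp
  · intro k _
    have hk : (⟨(k : ℕ), Nat.lt_of_succ_lt (Nat.add_lt_of_lt_sub k.isLt)⟩ : Fin L) ≠
      ⟨(k : ℕ) + 1, Nat.add_lt_of_lt_sub k.isLt⟩ := by simp
    generalize (⟨(k : ℕ), Nat.lt_of_succ_lt (Nat.add_lt_of_lt_sub k.isLt)⟩ : Fin L) = i at *
    generalize (⟨(k : ℕ) + 1, Nat.add_lt_of_lt_sub k.isLt⟩ : Fin L) = j at *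
    refine sum_eq_zero_of_antisymm _ (Equiv.arrowCongr (Equiv.swap i j) (Equiv.refl Bool))
      fun τ => ?_
    have hu (a b : Bool) : Function.update (Function.update (τ ∘ Equiv.swap i j) i a) j b =
        Function.update (Function.update τ i a) j b := by
      ext x
      by_cases hx : x = j
      · simp [hx]
      by_cases hx' : x = i
      · simp [hx', hk]
      · simp [hx, hx', Equiv.swap_apply_of_ne_of_ne]
    have he : Equiv.arrowCongr (Equiv.swap i j) (Equiv.refl Bool) τ = τ ∘ Equiv.swap i j := by
      ext x
      simp
    rw [he, hu, hu]
    simp only [Function.comp_apply, Equiv.swap_apply_left, Equiv.swap_apply_right]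
    ring
  · intro τ
    simp only [flip_apply, Function.update_self, Function.update_idem, indic_not]
    ring
  · intro τ
    simp only [flip_apply, Function.update_self, Function.update_idem, indic_not]
    ring

/-! ### One-signedness of the solutions -/

lemma entry_term_nonneg {ι : Type*} [DecidableEq ι] {a b : ℝ} (ha : 0 ≤ a) (hb : 0 ≤ b)
    {P : (ι → Bool) → ℝ} (hP : ∀ τ, 0 ≤ P τ) {τ : ι → Bool} (hτ : P τ = 0) (i : ι) :
    0 ≤ (indic (τ i) - indic (!τ i)) *
      (a * P (Function.update τ i false) - b * P (Function.update τ i true)) := by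
  cases h : τ i
  · rw [show Function.update τ i false = τ by rw [← h, Function.update_eq_self], hτ]
    simpa [indic] using mul_nonneg hb (hP _)
  · rw [show Function.update τ i true = τ by rw [← h, Function.update_eq_self], hτ]
    simpa [indic] using mul_nonneg ha (hP _)

lemma bulk_term_nonneg {ι : Type*} [DecidableEq ι] (hq : 0 ≤ q)
    {P : (ι → Bool) → ℝ} (hP : ∀ τ, 0 ≤ P τ) {τ : ι → Bool} (hτ : P τ = 0) (i j : ι) :
    0 ≤ (indic (τ j) - indic (τ i)) *
      (P (Function.update (Function.update τ i true) j false)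
        - q * P (Function.update (Function.update τ i false) j true)) := by
  have hu (a b : Bool) (hi : τ i = a) (hj : τ j = b) :
      Function.update (Function.update τ i a) j b = τ := by
    rw [← hi, Function.update_eq_self, ← hj, Function.update_eq_self]
  cases hi : τ i <;> cases hj : τ j
  · simp [indic]
  · rw [hu _ _ hi hj, hτ]
    simpa [indic] using hP _
  · rw [hu _ _ hi hj, hτ]
    simpa [indic] using mul_nonneg hq (hP _)
  · simp [indic]

lemma exit_term_nonneg {ι : Type*} [DecidableEq ι] {a b : ℝ} (ha : 0 ≤ a) (hb : 0 ≤ b)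
    {P : (ι → Bool) → ℝ} (hP : ∀ τ, 0 ≤ P τ) {τ : ι → Bool} (hτ : P τ = 0) (i : ι) :
    0 ≤ (indic (!τ i) - indic (τ i)) *
      (a * P (Function.update τ i true) - b * P (Function.update τ i false)) := by
  have h := entry_term_nonneg hb ha hP hτ i
  linarith

section Positivity

variable (hq : 0 ≤ q) (hα : 0 ≤ α) (hβ : 0 ≤ β) (hγ : 0 ≤ γ) (hδ : 0 ≤ δ)

include hq hα hβ hγ hδ

lemma generator_nonneg {P : (Fin L → Bool) → ℝ} (hP : ∀ τ, 0 ≤ P τ) {τ : Fin L → Bool}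
    (hτ : P τ = 0) : 0 ≤ generator q α β γ δ L hL P τ :=
  add_nonneg (add_nonneg (entry_term_nonneg hα hγ hP hτ _)
    (Finset.sum_nonneg fun _ _ => bulk_term_nonneg hq hP hτ _ _))
    (exit_term_nonneg hβ hδ hP hτ _)

lemma generator_max_zero {P : (Fin L → Bool) → ℝ}
    (h : ∀ τ, generator q α β γ δ L hL P τ = 0) (τ : Fin L → Bool) :
    generator q α β γ δ L hL (fun σ => max (P σ) 0) τ = 0 := by
  have hsplit : (fun σ => max (P σ) 0) = P + fun σ => max (-P σ) 0 := by
    ext σ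
    rcases le_total (P σ) 0 with h0 | h0 <;> simp [h0]
  have hnonneg (σ) : 0 ≤ generator q α β γ δ L hL (fun σ => max (P σ) 0) σ := by
    rcases le_total (P σ) 0 with h0 | h0
    · exact generator_nonneg hq hα hβ hγ hδ (fun _ => le_max_right _ _) (max_eq_right h0)
    · rw [hsplit, generator_add, h, zero_add]
      exact generator_nonneg hq hα hβ hγ hδ (fun _ => le_max_right _ _)
        (max_eq_right (neg_nonpos.mpr h0))
  exact (Finset.sum_eq_zero_iff_of_nonneg fun σ _ => hnonneg σ).mp
    (sum_generator _) τ (Finset.mem_univ τ)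

lemma generator_terms_eq_zero {P : (Fin L → Bool) → ℝ} (hP : ∀ τ, 0 ≤ P τ)
    {τ : Fin L → Bool} (hτ : P τ = 0) (h : generator q α β γ δ L hL P τ = 0) :
    (indic (τ ⟨0, hL⟩) - indic (!τ ⟨0, hL⟩)) *
        (α * P (Function.update τ ⟨0, hL⟩ false) - γ * P (Function.update τ ⟨0, hL⟩ true)) = 0 ∧
      ∀ (k : ℕ) (hk : k + 1 < L),
        (indic (τ ⟨k + 1, hk⟩) - indic (τ ⟨k, Nat.lt_of_succ_lt hk⟩)) *
          (P (Function.update (Function.update τ ⟨k, Nat.lt_of_succ_lt hk⟩ true) ⟨k + 1, hk⟩ false)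
          - q * P (Function.update (Function.update τ ⟨k, Nat.lt_of_succ_lt hk⟩ false)
              ⟨k + 1, hk⟩ true)) = 0 := by
  have h1 := entry_term_nonneg hα hγ hP hτ ⟨0, hL⟩
  have h2 (k : Fin (L - 1)) := bulk_term_nonneg hq hP hτ
    ⟨(k : ℕ), Nat.lt_of_succ_lt (Nat.add_lt_of_lt_sub k.isLt)⟩
    ⟨(k : ℕ) + 1, Nat.add_lt_of_lt_sub k.isLt⟩
  have h3 := exit_term_nonneg hβ hδ hP hτ ⟨L - 1, Nat.sub_lt hL Nat.one_pos⟩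
  have h4 := Finset.sum_nonneg fun k (_ : k ∈ Finset.univ) => h2 k
  rw [generator] at h
  refine ⟨by linarith, fun k hk => ?_⟩
  exact (Finset.sum_eq_zero_iff_of_nonneg fun k _ => h2 k).mp (by linarith)
    ⟨k, by omega⟩ (Finset.mem_univ _)

omit hq hα hβ hγ hδ in
lemma sum_update_add {ι : Type*} [Fintype ι] [DecidableEq ι] (g : ι → Bool → ℕ) (τ : ι → Bool)
    (i : ι) (b : Bool) :
    ∑ j, g j (Function.update τ i b j) + g i (τ i) = ∑ j, g j (τ j) + g i b := by
  rw [← Finset.add_sum_erase _ _ (Finset.mem_univ i),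
    ← Finset.add_sum_erase _ (fun j => g j (τ j)) (Finset.mem_univ i), Function.update_self,
    Finset.sum_congr rfl fun j hj => by rw [Function.update_of_ne (Finset.ne_of_mem_erase hj)]]
  ring

/-- A nonzero nonnegative solution charges the fully occupied configuration. -/
lemma pos_full {P : (Fin L → Bool) → ℝ} (hα' : 0 < α) (hP : ∀ τ, 0 ≤ P τ)
    (h : ∀ τ, generator q α β γ δ L hL P τ = 0) (hne : ∃ τ, 0 < P τ) :
    0 < P fun _ => true := by
  let g : Fin L → Bool → ℕ := fun j b => if b then (j : ℕ) + 1 else 0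
  obtain ⟨τ₀, hτ₀⟩ := hne
  obtain ⟨τ, hτ, hmax⟩ := Finset.exists_max_image (Finset.univ.filter fun τ => 0 < P τ)
    (fun τ => ∑ j, g j (τ j)) ⟨τ₀, by simpa using hτ₀⟩
  simp only [Finset.mem_filter, Finset.mem_univ, true_and] at hτ hmax
  have h0 : τ ⟨0, hL⟩ = true := by
    by_contra hf
    rw [Bool.not_eq_true] at hf
    have hs := sum_update_add g τ ⟨0, hL⟩ true
    have hPσ : 0 < P (Function.update τ ⟨0, hL⟩ true) := by
      refine (hP _).lt_of_ne fun he => ?_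
      have ht := (generator_terms_eq_zero hq hα hβ hγ hδ hP he.symm (h _)).1
      rw [Function.update_idem, Function.update_idem, ← he, Function.update_self,
        show Function.update τ ⟨0, hL⟩ false = τ by rw [← hf, Function.update_eq_self]] at ht
      have := mul_pos hα' hτ
      simp [indic] at ht
      rcases ht with ht | ht <;> linarith
    have hm := hmax _ hPσ
    rw [hf] at hs
    simp only [g] at hs hm
    simp at hs
    omega
  have hstep (k : ℕ) (hk : k + 1 < L) (hi : τ ⟨k, Nat.lt_of_succ_lt hk⟩ = true) :
      τ ⟨k + 1, hk⟩ = true := by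
    by_contra hj
    rw [Bool.not_eq_true] at hj
    have hs := sum_update_add g τ ⟨k, Nat.lt_of_succ_lt hk⟩ false
    have hs' := sum_update_add g (Function.update τ ⟨k, Nat.lt_of_succ_lt hk⟩ false)
      ⟨k + 1, hk⟩ true
    have hne : (⟨k, Nat.lt_of_succ_lt hk⟩ : Fin L) ≠ ⟨k + 1, hk⟩ := by simp
    have hPσ : 0 < P (Function.update (Function.update τ ⟨k, Nat.lt_of_succ_lt hk⟩ false)
        ⟨k + 1, hk⟩ true) := by
      refine (hP _).lt_of_ne fun he => ?_
      have ht := (generator_terms_eq_zero hq hα hβ hγ hδ hP he.symm (h _)).2 k hk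
      have hu (a b : Bool) : Function.update (Function.update (Function.update (Function.update τ
          ⟨k, Nat.lt_of_succ_lt hk⟩ false) ⟨k + 1, hk⟩ true) ⟨k, Nat.lt_of_succ_lt hk⟩ a)
          ⟨k + 1, hk⟩ b =
          Function.update (Function.update τ ⟨k, Nat.lt_of_succ_lt hk⟩ a) ⟨k + 1, hk⟩ b := by
        rw [Function.update_comm hne.symm, Function.update_idem, Function.update_idem]
      rw [hu, hu, ← he, Function.update_self, Function.update_of_ne hne, Function.update_self,
        show Function.update (Function.update τ ⟨k, Nat.lt_of_succ_lt hk⟩ true) ⟨k + 1, hk⟩ false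
          = τ by rw [← hi, Function.update_eq_self, ← hj, Function.update_eq_self]] at ht
      simp [indic] at ht
      linarith
    have hm := hmax _ hPσ
    rw [Function.update_of_ne hne.symm, hj] at hs'
    rw [hi] at hs
    simp only [g] at hs hs' hm
    simp at hs hs'
    omega
  have hall : ∀ (k : ℕ) (hk : k < L), τ ⟨k, hk⟩ = true := by
    intro k
    induction k with
    | zero => exact fun _ => h0
    | succ k ih => exact fun hk => hstep k hk (ih _)
  rwa [show τ = fun _ => true from funext fun j => hall j j.isLt] at hτ

lemma nonneg_or_nonpos {P : (Fin L → Bool) → ℝ} (hα' : 0 < α)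
    (h : ∀ τ, generator q α β γ δ L hL P τ = 0) : (∀ τ, 0 ≤ P τ) ∨ ∀ τ, P τ ≤ 0 := by
  by_contra! hcon
  obtain ⟨⟨σ, hσ⟩, τ, hτ⟩ := hcon
  have h' (τ) : generator q α β γ δ L hL (fun σ => -P σ) τ = 0 := by
    have hn : (fun σ => -P σ) = (-1 : ℝ) • P := by
      ext
      simp
    rw [hn, generator_smul, h, mul_zero]
  have h1 := pos_full hq hα hβ hγ hδ hα' (fun _ => le_max_right _ _)
    (generator_max_zero hq hα hβ hγ hδ h) ⟨τ, lt_max_of_lt_left hτ⟩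
  have h2 := pos_full hq hα hβ hγ hδ hα' (fun _ => le_max_right _ _)
    (generator_max_zero hq hα hβ hγ hδ h') ⟨σ, lt_max_of_lt_left (neg_pos.mpr hσ)⟩
  simp only [lt_max_iff, lt_self_iff_false, or_false] at h1 h2
  linarith

end Positivity

/-! ### Words in the generators -/

/-- The product of generators prescribed by a list of occupations. -/
def word (q : ℝ) (l : List Bool) : Malg q :=
  (l.map fun b => if b then Dgen q else Egen q).prod

lemma word_cons (b : Bool) (l : List Bool) :
    word q (b :: l) = (if b then Dgen q else Egen q) * word q l := by
  simp [word]

lemma word_append (l l' : List Bool) : word q (l ++ l') = word q l * word q l' := by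
  simp [word]

lemma word_ofFn (τ : Fin L → Bool) :
    (List.ofFn fun j : Fin L => if τ j then Dgen q else Egen q).prod = word q (List.ofFn τ) := by
  rw [word, List.map_ofFn]
  rfl

lemma ofFn_update (τ : Fin L → Bool) (i : Fin L) (b : Bool) :
    List.ofFn (Function.update τ i b) = (List.ofFn τ).set i b := by
  refine List.ext_getElem (by simp) fun n h₁ h₂ => ?_
  simp [List.getElem_set, Function.update_apply, Fin.ext_iff, eq_comm]

lemma sum_word (L : ℕ) :
    ∑ τ : Fin L → Bool, word q (List.ofFn τ) = (Dgen q + Egen q) ^ L := by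
  induction L with
  | zero => simp [word]
  | succ n ih =>
    rw [← (Fin.consEquiv fun _ => Bool).sum_comp, Fintype.sum_prod_type, pow_succ', ← ih]
    simp [Fin.consEquiv, List.ofFn_succ, word_cons, Finset.mul_sum, add_mul, Finset.sum_add_distrib]

lemma apply_word_bulk (φ : Malg q →ₗ[ℝ] ℝ) (u v : List Bool) :
    φ (word q (u ++ true :: false :: v)) - q * φ (word q (u ++ false :: true :: v)) =
      φ (word q (u ++ true :: v)) + φ (word q (u ++ false :: v)) := by
  have h := congrArg (fun A => φ (word q u * A * word q v)) (Dgen_mul_Egen q)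
  simpa [word_append, word_cons, mul_add, add_mul, mul_sub, sub_mul, mul_assoc] using h

lemma bulk_term_eq (φ : Malg q →ₗ[ℝ] ℝ) (l : List Bool) (k : ℕ) (hk : k + 1 < l.length) :
    (indic (l.getD (k + 1) false) - indic (l.getD k false)) *
        (φ (word q ((l.set k true).set (k + 1) false))
          - q * φ (word q ((l.set k false).set (k + 1) true))) =
      (indic (l.getD (k + 1) false) - indic (!l.getD (k + 1) false)) *
          φ (word q (l.eraseIdx (k + 1)))
        - (indic (l.getD k false) - indic (!l.getD k false)) * φ (word q (l.eraseIdx k)) := by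
  obtain ⟨u, a, b, v, rfl, rfl⟩ : ∃ u a b v, l = u ++ a :: b :: v ∧ u.length = k :=
    ⟨l.take k, l[k], l[k + 1], l.drop (k + 2), by simp, by simp; omega⟩
  have h := apply_word_bulk φ u v
  cases a <;> cases b <;>
    simp [indic, List.eraseIdx_append, h] <;> ring

/-- The matrix product ansatz solves the stationarity equations. -/
lemma generator_word (φ : Malg q →ₗ[ℝ] ℝ)
    (hleft : ∀ A, α * φ (Egen q * A) - γ * φ (Dgen q * A) = φ A)
    (hright : ∀ A, β * φ (A * Dgen q) - δ * φ (A * Egen q) = φ A) (τ : Fin L → Bool) :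
    generator q α β γ δ L hL (fun σ => φ (word q (List.ofFn σ))) τ = 0 := by
  have hτ (k : ℕ) (hk : k < L) : τ ⟨k, hk⟩ = (List.ofFn τ).getD k false := by simp [hk]
  simp only [generator, ofFn_update, hτ]
  have hlen : (List.ofFn τ).length = L := List.length_ofFn
  generalize List.ofFn τ = l at hlen
  subst hlen
  let R (k : ℕ) : ℝ :=
    (indic (l.getD k false) - indic (!l.getD k false)) * φ (word q (l.eraseIdx k))
  have hbulk (k : Fin (l.length - 1)) := bulk_term_eq φ l k (Nat.add_lt_of_lt_sub k.isLt)
  rw [Finset.sum_congr rfl fun k _ => hbulk k,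
    Fin.sum_univ_eq_sum_range (fun k => R (k + 1) - R k), Finset.sum_range_sub]
  have h0 : α * φ (word q (l.set 0 false)) - γ * φ (word q (l.set 0 true)) =
      φ (word q (l.eraseIdx 0)) := by
    obtain ⟨a, v, rfl⟩ := List.exists_cons_of_length_pos hL
    simpa [word_cons] using hleft (word q v)
  have h1 : β * φ (word q (l.set (l.length - 1) true))
      - δ * φ (word q (l.set (l.length - 1) false)) =
      φ (word q (l.eraseIdx (l.length - 1))) := by
    obtain ⟨u, a, rfl⟩ : ∃ u a, l = u ++ [a] :=
      ⟨_, _, (List.dropLast_append_getLast (List.ne_nil_of_length_pos hL)).symm⟩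
    simpa [word_append, word_cons, List.set_append, List.eraseIdx_append, word]
      using hright (word q u)
  rw [h0, h1]
  ring

lemma exists_word_ne_zero (φ : Malg q →ₗ[ℝ] ℝ) (h1 : φ 1 = 1)
    (hleft : ∀ A, α * φ (Egen q * A) - γ * φ (Dgen q * A) = φ A) (L : ℕ) :
    ∃ τ : Fin L → Bool, φ (word q (List.ofFn τ)) ≠ 0 := by
  induction L with
  | zero => exact ⟨Fin.elim0, by simp [word, h1]⟩
  | succ n ih =>
    obtain ⟨τ, hτ⟩ := ih
    by_contra! hcon
    have hE := hcon (Fin.cons false τ)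
    have hD := hcon (Fin.cons true τ)
    simp [List.ofFn_succ, word_cons] at hE hD
    have h := hleft (word q (List.ofFn τ))
    rw [hE, hD] at h
    exact hτ (by linarith)

end ASEP

theorem stmt1 (q α β γ δ : ℝ) (hq0 : 0 ≤ q) (hq1 : q < 1)
    (hα : 0 < α) (hβ : 0 < β) (hγ : 0 ≤ γ) (hδ : 0 ≤ δ)
    (hns : ∀ n : ℕ, α * β ≠ q ^ n * γ * δ) :
    ∃ φ₀ : Malg q →ₗ[ℝ] ℝ,
      ∀ (L : ℕ) (hL : 0 < L),
        φ₀ ((Dgen q + Egen q) ^ L) ≠ 0 ∧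
        (∀ τ : Fin L → Bool, 0 ≤ Pfun q φ₀ L τ) ∧
        (∑ τ : Fin L → Bool, Pfun q φ₀ L τ) = 1 ∧
        ASEPStationary q α β γ δ L hL (Pfun q φ₀ L) := by
  obtain ⟨φ, h1, hleft, hright⟩ := ASEP.exists_ansatz_functional hβ hns
  refine ⟨φ, fun L hL => ?_⟩
  let F : (Fin L → Bool) → ℝ := fun τ => φ (ASEP.word q (List.ofFn τ))
  have hF : ∀ τ, ASEP.generator q α β γ δ L hL F τ = 0 := ASEP.generator_word φ hleft hright
  have hsum : ∑ τ, F τ = φ ((Dgen q + Egen q) ^ L) := by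
    rw [← ASEP.sum_word, map_sum]
  obtain ⟨σ, hσ⟩ := ASEP.exists_word_ne_zero φ h1 hleft L
  have hsign := ASEP.nonneg_or_nonpos hq0 hα.le hβ.le hγ hδ hα hF
  have hP : Pfun q φ L = (φ ((Dgen q + Egen q) ^ L))⁻¹ • F := by
    ext τ
    rw [Pfun, ASEP.word_ofFn, Pi.smul_apply, smul_eq_mul, div_eq_inv_mul]
  have hZ : φ ((Dgen q + Egen q) ^ L) ≠ 0 := by
    rw [← hsum]
    intro h0
    rcases hsign with h | h
    · exact hσ ((Finset.sum_eq_zero_iff_of_nonneg fun τ _ => h τ).mp h0 σ (Finset.mem_univ σ))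
    · exact hσ ((Finset.sum_eq_zero_iff_of_nonpos fun τ _ => h τ).mp h0 σ (Finset.mem_univ σ))
  refine ⟨hZ, fun τ => ?_, ?_, ?_⟩
  · rw [hP, ← hsum, Pi.smul_apply, smul_eq_mul]
    rcases hsign with h | h
    · exact mul_nonneg (inv_nonneg.mpr (Finset.sum_nonneg fun τ _ => h τ)) (h τ)
    · exact mul_nonneg_of_nonpos_of_nonpos
        (inv_nonpos.mpr (Finset.sum_nonpos fun τ _ => h τ)) (h τ)
  · simp only [hP, Pi.smul_apply, smul_eq_mul]
    rw [← Finset.mul_sum, hsum, inv_mul_cancel₀ hZ]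
  · intro τ
    have h := ASEP.generator_smul (q := q) (α := α) (β := β) (γ := γ) (δ := δ) (hL := hL)
      (φ ((Dgen q + Egen q) ^ L))⁻¹ F τ
    rw [hF, mul_zero, ← hP] at h
    exact h

end
end

section
/- Let 0 < q < 1, let N ≥ 1 be an integer, let a, c > 0 and b, d ∈ (−1,0) satisfy a·b·c·d·q^N = 1, and assume a·c·q^j ≠ 1 for 0 ≤ j ≤ N−1. Define α, β, γ, δ by the Askey–Wilson parametrization (so α, β, γ, δ > 0). Let A be a unital associative ℂ-algebra containing elements 𝖾, 𝖽 with 𝖽𝖾 − q·𝖾𝖽 = 1; set θ = 1/√(1−q), 𝐄 = θ²·1 + θ·𝖾, 𝐃 = θ²·1 + θ·𝖽. Let φ : A → ℂ be ℂ-linear with φ(1) = 1 and with φ((α𝐄 − γ𝐃)·X) = φ(X) and φ(X·(β𝐃 − δ𝐄)) = φ(X) for every X which is a product of at most N−1 factors each equal to 𝐃 or 𝐄 (the empty product being 1). Let t ∈ ℂ, t ≠ 0, be such that a·b·t²·q^j ≠ 1 for 0 ≤ j ≤ N−1, and set 𝗑_t = (𝖾/t + t·𝖽)/(2θ) ∈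 A. Then for every integer n with 1 ≤ n ≤ N: φ(p_n(𝗑_t; a·t, b·t, c/t, d/t | q)) = 0, where the Askey–Wilson polynomial p_n (a polynomial with complex coefficients) is evaluated at the algebra element 𝗑_t. -/
noncomputable section

open scoped BigOperators

/-- The q-Pochhammer symbol `(a;q)_n = ∏_{j=0}^{n-1} (1 - a q^j)`. -/
def qPoch (q a : ℂ) (n : ℕ) : ℂ := ∏ j ∈ Finset.range n, (1 - a * q ^ j)

/-- The `n`-th Askey–Wilson polynomial `p_n(x; a,b,c,d | q)` as a polynomial in `x`. -/
def awPoly (q a b c d : ℂ) (n : ℕ) : Polynomial ℂ :=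
  Polynomial.C (a⁻¹ ^ n * qPoch q (a * b) n * qPoch q (a * c) n * qPoch q (a * d) n) *
    ∑ k ∈ Finset.range (n + 1),
      Polynomial.C (q ^ k * qPoch q (q⁻¹ ^ n) k * qPoch q (a * b * c * d * q ^ ((n : ℤ) - 1)) k /
          (qPoch q q k * qPoch q (a * b) k * qPoch q (a * c) k * qPoch q (a * d) k)) *
        ∏ j ∈ Finset.range k,
          (Polynomial.C (1 + a ^ 2 * q ^ (2 * j)) - Polynomial.C (2 * a * q ^ j) * Polynomial.X)

lemma qPoch_succ (q a : ℂ) (n : ℕ) :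
    qPoch q a (n + 1) = qPoch q a n * (1 - a * q ^ n) := by
  simp [qPoch, Finset.prod_range_succ]

lemma qPoch_succ_left (q a : ℂ) (n : ℕ) :
    qPoch q a (n + 1) = (1 - a) * qPoch q (a * q) n := by
  rw [qPoch, Finset.prod_range_succ', mul_comm, qPoch]
  congr 1
  · simp
  · exact Finset.prod_congr rfl fun j _ => by ring

lemma qPoch_ne_zero {q a : ℂ} {n : ℕ} (h : ∀ j < n, a * q ^ j ≠ 1) : qPoch q a n ≠ 0 :=
  Finset.prod_ne_zero_iff.2 fun j hj => sub_ne_zero.2 (h j (Finset.mem_range.1 hj)).symm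

/-- The partial sums of the series `₂φ₁(a, b; abq; q, q)` are products. -/
lemma sum_qPoch_telescope (q a b : ℂ) (n : ℕ) (hq : qPoch q q n ≠ 0)
    (hab : qPoch q (a * b * q) n ≠ 0) :
    ∑ k ∈ Finset.range (n + 1),
        q ^ k * qPoch q a k * qPoch q b k / (qPoch q q k * qPoch q (a * b * q) k) =
      qPoch q (a * q) n * qPoch q (b * q) n / (qPoch q q n * qPoch q (a * b * q) n) := by
  induction n with
  | zero => simp [qPoch]
  | succ n ih =>
    have h1 := hq
    have h2 := hab
    rw [qPoch_succ, mul_ne_zero_iff] at h1 h2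
    rw [Finset.sum_range_succ, ih h1.1 h2.1, qPoch_succ_left q a, qPoch_succ_left q b,
      qPoch_succ q q, qPoch_succ q (a * b * q), qPoch_succ q (a * q), qPoch_succ q (b * q)]
    obtain ⟨h1, h1'⟩ := h1
    obtain ⟨h2, h2'⟩ := h2
    generalize qPoch q (a * b * q) n = p at *
    generalize hw : 1 - a * b * q * q ^ n = w at *
    field_simp
    rw [← hw]
    ring

lemma sum_qPoch_eq_zero (q Q : ℂ) (hq0 : q ≠ 0) (n : ℕ) (hn : 1 ≤ n) (hq : qPoch q q n ≠ 0)
    (hQ : qPoch q Q n ≠ 0) :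
    ∑ k ∈ Finset.range (n + 1),
        q ^ k * qPoch q (q⁻¹ ^ n) k * qPoch q (Q * q ^ ((n : ℤ) - 1)) k /
          (qPoch q q k * qPoch q Q k) = 0 := by
  have hab : q⁻¹ ^ n * (Q * q ^ ((n : ℤ) - 1)) * q = Q := by
    rw [zpow_sub_one₀ hq0, zpow_natCast, inv_pow]
    field_simp
  have key := sum_qPoch_telescope q (q⁻¹ ^ n) (Q * q ^ ((n : ℤ) - 1)) n hq (by rwa [hab])
  rw [hab] at key
  rw [key]
  have h0 : qPoch q (q⁻¹ ^ n * q) n = 0 := by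
    refine Finset.prod_eq_zero (Finset.mem_range.2 (Nat.sub_lt hn one_pos)) ?_
    rw [mul_assoc, ← pow_succ', Nat.sub_add_cancel hn, inv_pow,
      inv_mul_cancel₀ (pow_ne_zero _ hq0), sub_self]
  rw [h0]
  simp

section QOscillator

variable {R : Type*} [Ring R] [Algebra ℂ R]

/-- The product `(z e; q)_k` in a possibly noncommutative algebra. -/
def qPochElem (q : ℂ) (e : R) (z : ℂ) : ℕ → R
  | 0 => 1
  | k + 1 => qPochElem q e z k * (1 - (z * q ^ k) • e)

lemma commute_qPochElem (q : ℂ) (e : R) (z : ℂ) (k : ℕ) : Commute e (qPochElem q e z k) := by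
  induction k with
  | zero => exact Commute.one_right e
  | succ k ih =>
    exact ih.mul_right ((Commute.one_right e).sub_right ((Commute.refl e).smul_right _))

lemma qPochElem_succ_left (q : ℂ) (e : R) (z : ℂ) (k : ℕ) :
    qPochElem q e z (k + 1) = (1 - z • e) * qPochElem q e (z * q) k := by
  induction k with
  | zero => simp [qPochElem]
  | succ k ih =>
    rw [qPochElem, ih, qPochElem, mul_assoc, pow_succ', mul_assoc z q]

lemma qPochElem_succ_left' (q : ℂ) (e : R) (z : ℂ) (k : ℕ) :
    qPochElem q e z (k + 1) = qPochElem q e (z * q) k * (1 - z • e) := by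
  rw [qPochElem_succ_left]
  exact ((Commute.one_left _).sub_left ((commute_qPochElem q e (z * q) k).smul_left z))

lemma mul_qPochElem {q : ℂ} {e d : R} (hde : d * e = q • (e * d) + (1 - q) • (1 : R))
    (z : ℂ) (k : ℕ) :
    d * qPochElem q e z k =
      (z * q ^ k) • qPochElem q e z k + qPochElem q e (z * q) k * (d - z • (1 : R)) := by
  induction k with
  | zero => simp [qPochElem]
  | succ k ih =>
    have hG := qPochElem_succ_left' q e z k
    have hlin : (d - z • (1 : R)) * (1 - (z * q ^ k) • e) =
        (1 - (z * q * q ^ k) • e) * (d - z • (1 : R)) -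
          (z * q ^ k * (1 - q)) • (1 - z • e) := by
      simp only [mul_sub, sub_mul, mul_one, one_mul, smul_mul_assoc, mul_smul_comm, hde]
      module
    have hstep : d * qPochElem q e z (k + 1) =
        (z * q ^ k) • qPochElem q e z (k + 1) +
          qPochElem q e (z * q) k * ((d - z • (1 : R)) * (1 - (z * q ^ k) • e)) := by
      rw [qPochElem, ← mul_assoc, ih, add_mul, smul_mul_assoc, mul_assoc]
    rw [hstep, hlin, mul_sub, mul_smul_comm, ← hG, ← mul_assoc,
      show qPochElem q e (z * q) (k + 1) =
        qPochElem q e (z * q) k * (1 - (z * q * q ^ k) • e) from rfl]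
    module

lemma linear_mem_span {e d : R} (r s u : ℂ) :
    r • (1 : R) + s • e + u • d ∈ Submodule.span ℂ {1, e, d} := by
  refine Submodule.add_mem _ (Submodule.add_mem _ ?_ ?_) ?_ <;>
    exact Submodule.smul_mem _ _ (Submodule.subset_span (by simp))

lemma qPochElem_mem (q : ℂ) (e d : R) (z : ℂ) (k : ℕ) :
    qPochElem q e z k ∈ Submodule.span ℂ {1, e, d} ^ k := by
  induction k with
  | zero => exact Submodule.one_le.1 (pow_zero (Submodule.span ℂ {1, e, d})).ge
  | succ k ih =>
    rw [pow_succ]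
    refine Submodule.mul_mem_mul ih ?_
    have := linear_mem_span (e := e) (d := d) 1 (-(z * q ^ k)) 0
    convert this using 1
    module

variable {q A B C D : ℂ} {N : ℕ} {e d : R} {φ : R →ₗ[ℂ] ℂ}

/-- Modulo the right boundary relation, `∏ (1 + A²q²ʲ - A qʲ (e + d))` acts as a multiple of
`(A e; q)_k`. -/
lemma functional_prod_eq (hde : d * e = q • (e * d) + (1 - q) • (1 : R))
    (hV : ∀ m, m + 1 ≤ N → ∀ Y ∈ Submodule.span ℂ {1, e, d} ^ m,
      φ (Y * (d + (A * B) • e)) = (A + B) * φ Y)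
    (P : ℕ → R) (hP0 : P 0 = 1)
    (hP : ∀ k, P (k + 1) = ((1 + A ^ 2 * q ^ (2 * k)) • (1 : R) - (A * q ^ k) • (e + d)) * P k)
    (k : ℕ) : ∀ m, m + k ≤ N → ∀ Y ∈ Submodule.span ℂ {1, e, d} ^ m,
      φ (Y * P k) = qPoch q (A * B) k * φ (Y * qPochElem q e A k) := by
  induction k with
  | zero => intro m _ Y _; simp [hP0, qPoch, qPochElem]
  | succ k ih =>
    intro m hm Y hY
    have hF : Y * ((1 + A ^ 2 * q ^ (2 * k)) • (1 : R) - (A * q ^ k) • (e + d)) ∈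
        Submodule.span ℂ {1, e, d} ^ (m + 1) := by
      rw [pow_succ]
      refine Submodule.mul_mem_mul hY ?_
      have := linear_mem_span (e := e) (d := d) (1 + A ^ 2 * q ^ (2 * k)) (-(A * q ^ k))
        (-(A * q ^ k))
      convert this using 1
      module
    have hH : Y * qPochElem q e (A * q) k ∈ Submodule.span ℂ {1, e, d} ^ (m + k) := by
      rw [pow_add]
      exact Submodule.mul_mem_mul hY (qPochElem_mem q e d _ k)
    have hv := hV (m + k) (by omega) _ hH
    have hG := qPochElem_succ_left' q e A k
    have he : qPochElem q e A (k + 1) =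
        qPochElem q e A k - (A * q ^ k) • (e * qPochElem q e A k) := by
      rw [qPochElem, mul_sub, mul_one, mul_smul_comm, (commute_qPochElem q e A k).eq]
    have hd := mul_qPochElem hde A k
    have hmain : ((1 + A ^ 2 * q ^ (2 * k)) • (1 : R) - (A * q ^ k) • (e + d)) *
          qPochElem q e A k =
        (1 - A * B * q ^ k) • qPochElem q e A (k + 1) - (A * q ^ k) •
          (qPochElem q e (A * q) k * (d + (A * B) • e) - (A + B) • qPochElem q e (A * q) k) := by
      have hcomb : qPochElem q e (A * q) k * (d - A • (1 : R)) =
          B • qPochElem q e A (k + 1) + (qPochElem q e (A * q) k * (d + (A * B) • e) -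
            (A + B) • qPochElem q e (A * q) k) := by
        rw [hG]
        simp only [mul_sub, mul_add, mul_one, mul_smul_comm]
        module
      rw [sub_mul, smul_mul_assoc, one_mul, smul_mul_assoc, add_mul, hd, hcomb,
        sub_smul 1 (A * B * q ^ k), he]
      module
    rw [hP, ← mul_assoc, ih (m + 1) (by omega) _ hF, mul_assoc, hmain, qPoch_succ]
    simp only [mul_sub, mul_smul_comm, map_sub, map_smul, smul_eq_mul, ← mul_assoc] at hv ⊢
    simp only [hv]
    ring

lemma functional_qPochElem_succ (hde : d * e = q • (e * d) + (1 - q) • (1 : R))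
    (hV : ∀ m, m + 1 ≤ N → ∀ Y ∈ Submodule.span ℂ {1, e, d} ^ m,
      φ (Y * (d + (A * B) • e)) = (A + B) * φ Y)
    (hW : ∀ m, m + 1 ≤ N → ∀ Y ∈ Submodule.span ℂ {1, e, d} ^ m,
      φ ((e + (C * D) • d) * Y) = (C + D) * φ Y) (k : ℕ) (hk : k + 1 ≤ N) :
    (1 - A * B * C * D * q ^ k) * φ (qPochElem q e A (k + 1)) =
      (1 - A * C * q ^ k) * (1 - A * D * q ^ k) * φ (qPochElem q e A k) := by
  have hw := hW k hk _ (qPochElem_mem q e d A k)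
  have hv := hV k hk _ (qPochElem_mem q e d (A * q) k)
  have hG : φ (qPochElem q e A (k + 1)) = φ (qPochElem q e (A * q) k) -
      A * φ (qPochElem q e (A * q) k * e) := by
    rw [qPochElem_succ_left']
    simp [mul_sub]
  have he : φ (qPochElem q e A (k + 1)) =
      φ (qPochElem q e A k) - (A * q ^ k) * φ (e * qPochElem q e A k) := by
    rw [qPochElem, mul_sub, mul_one, mul_smul_comm, (commute_qPochElem q e A k).eq]
    simp
  have hd := congrArg φ (mul_qPochElem hde A k)
  simp only [mul_add, add_mul, mul_sub, mul_one, mul_smul_comm, smul_mul_assoc, map_add, map_sub,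
    map_smul, smul_eq_mul] at hw hv hd
  linear_combination (1 - A * B * C * D * q ^ k) * he - A * q ^ k * hw +
    A * q ^ k * C * D * hd + A * q ^ k * C * D * hv - A * B * C * D * q ^ k * hG +
    A * B * C * D * q ^ k * he

lemma functional_prod_moment (hde : d * e = q • (e * d) + (1 - q) • (1 : R))
    (hV : ∀ m, m + 1 ≤ N → ∀ Y ∈ Submodule.span ℂ {1, e, d} ^ m,
      φ (Y * (d + (A * B) • e)) = (A + B) * φ Y)
    (hW : ∀ m, m + 1 ≤ N → ∀ Y ∈ Submodule.span ℂ {1, e, d} ^ m,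
      φ ((e + (C * D) • d) * Y) = (C + D) * φ Y)
    (hone : φ 1 = 1) (P : ℕ → R) (hP0 : P 0 = 1)
    (hP : ∀ k, P (k + 1) = ((1 + A ^ 2 * q ^ (2 * k)) • (1 : R) - (A * q ^ k) • (e + d)) * P k)
    (k : ℕ) (hk : k ≤ N) :
    qPoch q (A * B * C * D) k * φ (P k) =
      qPoch q (A * B) k * qPoch q (A * C) k * qPoch q (A * D) k := by
  have h1 := functional_prod_eq hde hV P hP0 hP k 0 (by omega) 1
    (Submodule.one_le.1 (pow_zero (Submodule.span ℂ {1, e, d})).ge)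
  rw [one_mul, one_mul] at h1
  have h2 : qPoch q (A * B * C * D) k * φ (qPochElem q e A k) =
      qPoch q (A * C) k * qPoch q (A * D) k := by
    clear h1
    induction k with
    | zero => simp [qPoch, qPochElem, hone]
    | succ k ih =>
      have := functional_qPochElem_succ hde hV hW k hk
      rw [qPoch_succ, qPoch_succ, qPoch_succ]
      linear_combination qPoch q (A * B * C * D) k * this +
        (1 - A * C * q ^ k) * (1 - A * D * q ^ k) * ih (by omega)
  rw [h1]
  linear_combination qPoch q (A * B) k * h2

lemma functional_awPoly_eq_zero (hq0 : q ≠ 0)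
    (hde : d * e = q • (e * d) + (1 - q) • (1 : R))
    (hV : ∀ m, m + 1 ≤ N → ∀ Y ∈ Submodule.span ℂ {1, e, d} ^ m,
      φ (Y * (d + (A * B) • e)) = (A + B) * φ Y)
    (hW : ∀ m, m + 1 ≤ N → ∀ Y ∈ Submodule.span ℂ {1, e, d} ^ m,
      φ ((e + (C * D) • d) * Y) = (C + D) * φ Y)
    (hone : φ 1 = 1)
    (hq : ∀ j < N, q * q ^ j ≠ 1) (hAB : ∀ j < N, A * B * q ^ j ≠ 1)
    (hAC : ∀ j < N, A * C * q ^ j ≠ 1) (hAD : ∀ j < N, A * D * q ^ j ≠ 1)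
    (hABCD : ∀ j < N, A * B * C * D * q ^ j ≠ 1) (n : ℕ) (hn : 1 ≤ n) (hnN : n ≤ N) :
    φ (Polynomial.aeval ((2 : ℂ)⁻¹ • (e + d)) (awPoly q A B C D n)) = 0 := by
  set P : ℕ → R := fun k => Polynomial.aeval ((2 : ℂ)⁻¹ • (e + d)) (∏ j ∈ Finset.range k,
    (Polynomial.C (1 + A ^ 2 * q ^ (2 * j)) - Polynomial.C (2 * A * q ^ j) * Polynomial.X))
    with hPdef
  have hP0 : P 0 = 1 := by simp [P]
  have hP : ∀ k, P (k + 1) =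
      ((1 + A ^ 2 * q ^ (2 * k)) • (1 : R) - (A * q ^ k) • (e + d)) * P k := by
    intro k
    simp only [hPdef]
    rw [Finset.prod_range_succ, mul_comm, map_mul]
    congr 1
    simp only [map_sub, map_mul, Polynomial.aeval_C, Polynomial.aeval_X]
    rw [← map_mul, ← map_mul, Algebra.algebraMap_eq_smul_one, Algebra.algebraMap_eq_smul_one,
      smul_mul_assoc, one_mul]
    module
  have hmom := functional_prod_moment hde hV hW hone P hP0 hP
  have hne {a : ℂ} (h : ∀ j < N, a * q ^ j ≠ 1) {k : ℕ} (hk : k ≤ N) : qPoch q a k ≠ 0 :=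
    qPoch_ne_zero fun j hj => h j (hj.trans_le hk)
  have hsum := sum_qPoch_eq_zero q (A * B * C * D) hq0 n hn (hne hq hnN) (hne hABCD hnN)
  rw [awPoly, map_mul, Polynomial.aeval_C, Algebra.algebraMap_eq_smul_one, smul_mul_assoc, one_mul,
    map_smul, map_sum, map_sum]
  refine smul_eq_zero_of_right _ (Eq.trans (Finset.sum_congr rfl fun k hk => ?_) hsum)
  have hkN : k ≤ N := (Nat.lt_succ_iff.1 (Finset.mem_range.1 hk)).trans hnN
  rw [map_mul, Polynomial.aeval_C, Algebra.algebraMap_eq_smul_one, smul_mul_assoc, one_mul,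
    map_smul, smul_eq_mul]
  change _ * φ (P k) = _
  have h0 := hne hq hkN
  have h1 := hne hAB hkN
  have h2 := hne hAC hkN
  have h3 := hne hAD hkN
  have h4 := hne hABCD hkN
  rw [eq_div_of_mul_eq h4 ((mul_comm _ _).trans (hmom k hkN))]
  field_simp

/-- An affine change of generators does not change the span of `1` and the generators. -/
lemma span_one_affine_le {x y x' y' : R} {r s u v : ℂ} (hx : x = r • (1 : R) + s • x')
    (hy : y = u • (1 : R) + v • y') :
    Submodule.span ℂ {1, x, y} ≤ Submodule.span ℂ {1, x', y'} := by
  have h1 : (1 : R) ∈ Submodule.span ℂ {1, x', y'} := Submodule.subset_span (by simp)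
  rw [Submodule.span_le]
  rintro z (rfl | rfl | rfl)
  · exact h1
  · rw [hx]
    exact add_mem (Submodule.smul_mem _ _ h1)
      (Submodule.smul_mem _ _ (Submodule.subset_span (by simp)))
  · rw [hy]
    exact add_mem (Submodule.smul_mem _ _ h1)
      (Submodule.smul_mem _ _ (Submodule.subset_span (by simp)))

lemma span_pow_le_span_list_prod (x y : R) (m : ℕ) :
    Submodule.span ℂ {1, x, y} ^ m ≤ Submodule.span ℂ
      {z | ∃ l : List R, (∀ w ∈ l, w = y ∨ w = x) ∧ l.length ≤ m ∧ z = l.prod} := by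
  induction m with
  | zero =>
    rw [pow_zero, Submodule.one_eq_span]
    exact Submodule.span_mono fun z hz => ⟨[], by simp, by simp, by simpa using hz⟩
  | succ m ih =>
    rw [pow_succ']
    refine (mul_le_mul' le_rfl ih).trans ?_
    rw [Submodule.span_mul_span]
    refine Submodule.span_mono ?_
    rintro _ ⟨g, hg, _, ⟨l, hl, hlen, rfl⟩, rfl⟩
    rcases hg with rfl | rfl | rfl
    · exact ⟨l, hl, by omega, by simp⟩
    · exact ⟨g :: l, by simpa using hl, by simpa using hlen, by simp⟩
    · exact ⟨g :: l, by simpa using hl, by simpa using hlen, by simp⟩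

end QOscillator

theorem stmt4 (q : ℝ) (hq0 : 0 < q) (hq1 : q < 1) (N : ℕ) (hN1 : 1 ≤ N)
    (a b c d : ℝ) (ha : 0 < a) (hc : 0 < c)
    (hb1 : -1 < b) (hb0 : b < 0) (hd1 : -1 < d) (hd0 : d < 0)
    (hsing : a * b * c * d * q ^ N = 1)
    (hac : ∀ j : ℕ, j < N → a * c * q ^ j ≠ 1)
    (α β γ δ : ℝ)
    (hα : α = (1 - q) / ((1 + c) * (1 + d)))
    (hβ : β = (1 - q) / ((1 + a) * (1 + b)))
    (hγ : γ = -((1 - q) * c * d) / ((1 + c) * (1 + d)))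
    (hδ : δ = -((1 - q) * a * b) / ((1 + a) * (1 + b)))
    (A : Type*) [Ring A] [Algebra ℂ A] (e dd : A)
    (hde : dd * e - (q : ℂ) • (e * dd) = 1)
    (θ : ℝ) (hθ : θ = 1 / Real.sqrt (1 - q))
    (E D : A)
    (hE : E = ((θ : ℂ) ^ 2) • (1 : A) + (θ : ℂ) • e)
    (hD : D = ((θ : ℂ) ^ 2) • (1 : A) + (θ : ℂ) • dd)
    (φ : A →ₗ[ℂ] ℂ) (hone : φ 1 = 1)
    (hW : ∀ l : List A, (∀ x ∈ l, x = D ∨ x = E) → l.length + 1 ≤ N →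
      φ (((α : ℂ) • E - (γ : ℂ) • D) * l.prod) = φ l.prod)
    (hV : ∀ l : List A, (∀ x ∈ l, x = D ∨ x = E) → l.length + 1 ≤ N →
      φ (l.prod * ((β : ℂ) • D - (δ : ℂ) • E)) = φ l.prod)
    (t : ℂ) (ht : t ≠ 0)
    (habt : ∀ j : ℕ, j < N → (a : ℂ) * (b : ℂ) * t ^ 2 * (q : ℂ) ^ j ≠ 1)
    (xt : A) (hxt : xt = ((2 * (θ : ℂ))⁻¹) • (t⁻¹ • e + t • dd)) :
    ∀ n : ℕ, 1 ≤ n → n ≤ N →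
      φ (Polynomial.aeval xt
          (awPoly (q : ℂ) ((a : ℂ) * t) ((b : ℂ) * t) ((c : ℂ) / t) ((d : ℂ) / t) n)) = 0 := by
  have hq1' : (1 : ℝ) - q > 0 := sub_pos.2 hq1
  have hθ0 : (θ : ℂ) ≠ 0 := by
    rw [hθ]
    exact_mod_cast (one_div_pos.2 (Real.sqrt_pos.2 hq1')).ne'
  have hθ2 : (θ : ℂ) ^ 2 * (1 - q) = 1 := by
    have : θ ^ 2 * (1 - q) = 1 := by
      rw [hθ, div_pow, Real.sq_sqrt hq1'.le, one_pow, one_div_mul_cancel hq1'.ne']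
    exact_mod_cast this
  have hqC : (q : ℂ) ≠ 0 := by exact_mod_cast hq0.ne'
  set e' : A := ((θ : ℂ) * t)⁻¹ • e with he'
  set d' : A := ((θ : ℂ)⁻¹ * t) • dd with hd'
  have heE : e' = (-(θ : ℂ) * (θ * t)⁻¹) • (1 : A) + ((θ * t)⁻¹ * (θ : ℂ)⁻¹) • E := by
    rw [he', hE]
    match_scalars <;> field_simp
    ring
  have hdD : d' = (-t) • (1 : A) + ((θ : ℂ)⁻¹ * t * (θ : ℂ)⁻¹) • D := by
    rw [hd', hD]
    match_scalars <;> field_simp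
    ring
  have hEe : E = ((θ : ℂ) ^ 2) • (1 : A) + ((θ : ℂ) ^ 2 * t) • e' := by
    rw [hE, he']
    match_scalars <;> field_simp
  have hDd : D = ((θ : ℂ) ^ 2) • (1 : A) + ((θ : ℂ) ^ 2 * t⁻¹) • d' := by
    rw [hD, hd']
    match_scalars <;> field_simp
  have hspan (m : ℕ) : Submodule.span ℂ {1, e', d'} ^ m ≤ Submodule.span ℂ
      {z | ∃ l : List A, (∀ w ∈ l, w = D ∨ w = E) ∧ l.length ≤ m ∧ z = l.prod} :=
    (pow_le_pow_left' (span_one_affine_le heE hdD) m).trans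
      (span_pow_le_span_list_prod E D m)
  have hde' : d' * e' = (q : ℂ) • (e' * d') + (1 - (q : ℂ)) • (1 : A) := by
    have h := sub_eq_iff_eq_add.1 hde
    rw [he', hd']
    simp only [smul_mul_assoc, mul_smul_comm, h]
    match_scalars
    · field_simp
      linear_combination -hθ2
    · field_simp
  have hc1 : (1 : ℂ) + c ≠ 0 := by exact_mod_cast (by linarith : 0 < 1 + c).ne'
  have hd1' : (1 : ℂ) + d ≠ 0 := by exact_mod_cast (by linarith : 0 < 1 + d).ne'
  have ha1 : (1 : ℂ) + a ≠ 0 := by exact_mod_cast (by linarith : 0 < 1 + a).ne'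
  have hb1' : (1 : ℂ) + b ≠ 0 := by exact_mod_cast (by linarith : 0 < 1 + b).ne'
  have hVspan : ∀ m, m + 1 ≤ N → ∀ Y ∈ Submodule.span ℂ {1, e', d'} ^ m,
      φ (Y * (d' + ((a * t) * (b * t) : ℂ) • e')) = (a * t + b * t) * φ Y := by
    intro m hm Y hY
    refine Submodule.span_induction (p := fun Y _ =>
      φ (Y * (d' + ((a * t) * (b * t) : ℂ) • e')) = (a * t + b * t) * φ Y)
      ?_ ?_ ?_ ?_ (hspan m hY)
    · rintro _ ⟨l, hl, hlen, rfl⟩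
      have h := hV l hl (by omega)
      rw [hEe, hDd, hβ, hδ] at h
      push_cast at h
      simp only [mul_add, mul_sub, mul_smul_comm, mul_one, map_add, map_sub, map_smul,
        smul_eq_mul] at h ⊢
      generalize φ l.prod = p at *
      generalize φ (l.prod * d') = p1 at *
      generalize φ (l.prod * e') = p2 at *
      field_simp at h
      linear_combination h - (p * t + p1 - a * b * t * (-p + -(t * p2))) * hθ2
    · simp
    · intro x y _ _ hx hy
      rw [add_mul, map_add, map_add, hx, hy, mul_add]
    · intro r x _ hx
      rw [smul_mul_assoc, map_smul, map_smul, hx, smul_eq_mul, smul_eq_mul, mul_left_comm]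
  have hWspan : ∀ m, m + 1 ≤ N → ∀ Y ∈ Submodule.span ℂ {1, e', d'} ^ m,
      φ ((e' + ((c / t) * (d / t) : ℂ) • d') * Y) = (c / t + d / t) * φ Y := by
    intro m hm Y hY
    refine Submodule.span_induction (p := fun Y _ =>
      φ ((e' + ((c / t) * (d / t) : ℂ) • d') * Y) = (c / t + d / t) * φ Y)
      ?_ ?_ ?_ ?_ (hspan m hY)
    · rintro _ ⟨l, hl, hlen, rfl⟩
      have h := hW l hl (by omega)
      rw [hEe, hDd, hα, hγ] at h
      push_cast at h
      simp only [add_mul, sub_mul, smul_mul_assoc, one_mul, map_add, map_sub, map_smul, smul_add,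
        smul_eq_mul] at h ⊢
      generalize φ l.prod = p at *
      generalize φ (d' * l.prod) = p1 at *
      generalize φ (e' * l.prod) = p2 at *
      field_simp at h
      field_simp
      linear_combination h - (t * (p + t * p2) - d * c * (-(p * t) + -p1)) * hθ2
    · simp
    · intro x y _ _ hx hy
      rw [mul_add, map_add, map_add, hx, hy, mul_add]
    · intro r x _ hx
      rw [mul_smul_comm, map_smul, map_smul, hx, smul_eq_mul, smul_eq_mul, mul_left_comm]
  have hx : xt = (2 : ℂ)⁻¹ • (e' + d') := by
    rw [hxt, he', hd']
    match_scalars <;> field_simp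
  have hsing' : (a * b * c * d * q ^ N : ℂ) = 1 := by exact_mod_cast hsing
  have hpow (j : ℕ) : (q : ℂ) * q ^ j ≠ 1 := by
    have : q * q ^ j ≠ 1 := by
      rw [← pow_succ']
      exact (pow_lt_one₀ hq0.le hq1 j.succ_ne_zero).ne
    exact_mod_cast this
  have hABCD : (a * t * (b * t) * (c / t) * (d / t) : ℂ) = a * b * c * d := by field_simp
  have hAC : (a * t * (c / t) : ℂ) = a * c := by field_simp
  have hAD : (a * t * (d / t) : ℂ) = a * d := by field_simp
  intro n hn hnN
  rw [hx]
  refine functional_awPoly_eq_zero hqC hde' hVspan hWspan hone (fun j _ => hpow j) ?_ ?_ ?_ ?_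
    n hn hnN
  · intro j hj h
    exact habt j hj (by rw [← h]; ring)
  · intro j hj
    rw [hAC]
    exact_mod_cast hac j hj
  · intro j hj
    rw [hAD]
    have : a * d * q ^ j ≠ 1 :=
      ((mul_neg_of_neg_of_pos (mul_neg_of_pos_of_neg ha hd0) (pow_pos hq0 j)).trans one_pos).ne
    exact_mod_cast this
  · intro j hj h
    rw [hABCD] at h
    obtain ⟨i, rfl⟩ := Nat.exists_eq_add_of_lt hj
    refine hpow i ?_
    rw [add_assoc, pow_add, ← mul_assoc, h, one_mul, pow_succ'] at hsing'
    exact hsing'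

end
end
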